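/- arXiv:0907.1274 — 3 statements merged into one kernel-verified Lean document; each statement's English description precedes it below -/
import Mathlib

section
/- Let ρ0∈L¹(0,1) and u∈L¹(0,T) be nonnegative a.e., let ρ∈C⁰([0,T];L¹(0,1)) be the unique weak solution of the Cauchy problem, W(t):=∫₀¹ρ(t,x)dx, and let ξ∈C¹([0,T]) satisfy ξ(0)=0 and ξ'(t)=λ(W(t)). Then for 0≤t≤ξ^{-1}(1) one has W(t)=∫₀ᵗ u(σ)dσ + ∫₀^{1−ξ(t)} ρ0(y)dy, and for t≥ξ^{-1}(1) (when ξ(T)>1) one has W(t)=∫_{ξ^{-1}(ξ(t)−1)}^{t} u(σ)dσ; in particular 0 ≤ W(t) ≤ M := ‖u‖_{L¹(0,T)}+‖ρ0‖_{L¹(0,1)} and 0 < λ̃(M) ≤ ξ'(t) ≤ λ̄(M) for all t∈[0,T]. -/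
open MeasureTheory Set intervalIntegral

noncomputable section

/-- A weak solution of the Cauchy problem
`∂_t ρ + ∂_x (λ(W(t)) ρ) = 0`, `W(t) = ∫₀¹ ρ(t,x) dx`,
with initial datum `ρ(0,·) = ρ₀` and boundary datum `λ(W(t)) ρ(t,0) = u(t)`. -/
def IsWeakSolution (lam : ℝ → ℝ) (T : ℝ) (ρ₀ u : ℝ → ℝ) (ρ : ℝ → ℝ → ℝ) : Prop :=
  (∀ t ∈ Set.Icc (0:ℝ) T, MeasureTheory.IntegrableOn (ρ t) (Set.Ioc 0 1)) ∧
  (∀ t ∈ Set.Icc (0:ℝ) T, ∀ ε > (0:ℝ), ∃ η > (0:ℝ), ∀ s ∈ Set.Icc (0:ℝ) T,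
      |s - t| < η → (∫ x in Set.Ioc (0:ℝ) 1, |ρ s x - ρ t x|) < ε) ∧
  (∀ τ ∈ Set.Icc (0:ℝ) T, ∀ φ : ℝ → ℝ → ℝ,
      ContDiff ℝ 1 (Function.uncurry φ) →
      (∀ x ∈ Set.Icc (0:ℝ) 1, φ τ x = 0) →
      (∀ t ∈ Set.Icc (0:ℝ) τ, φ t 1 = 0) →
      (∫ t in Set.Ioc (0:ℝ) τ, ∫ x in Set.Ioc (0:ℝ) 1,
          ρ t x * (deriv (fun s => φ s x) t
            + lam (∫ y in Set.Ioc (0:ℝ) 1, ρ t y) * deriv (φ t) x))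
        + (∫ t in Set.Ioc (0:ℝ) τ, u t * φ t 0)
        + (∫ x in Set.Ioc (0:ℝ) 1, ρ₀ x * φ 0 x) = 0)

/-- `λ̃(M) = inf_{0 ≤ W ≤ M} λ(W)`. -/
def lamInf (lam : ℝ → ℝ) (M : ℝ) : ℝ := sInf (lam '' Set.Icc 0 M)

/-- `λ̄(M) = sup_{0 ≤ W ≤ M} λ(W)`. -/
def lamSup (lam : ℝ → ℝ) (M : ℝ) : ℝ := sSup (lam '' Set.Icc 0 M)

/-- If the second primitive of `v` plus a linear term agrees with the primitive of a continuous
function `g`, then differentiating at the right endpoint gives `g b = ∫₀ᵇ v + c`. -/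
lemma eq_integral_add_of_forall_integral_eq {g v : ℝ → ℝ} {b c : ℝ} (hb : 0 < b)
    (hg : ContinuousOn g (Set.Icc 0 b)) (hv : IntervalIntegrable v volume 0 b)
    (h : ∀ τ ∈ Set.Icc (0:ℝ) b,
      ∫ t in (0:ℝ)..τ, g t = (∫ t in (0:ℝ)..τ, (τ - t) * v t) + τ * c) :
    g b = (∫ t in (0:ℝ)..b, v t) + c := by
  have hbm : b ∈ Set.Icc 0 b := ⟨hb.le, le_rfl⟩
  have hud : UniqueDiffWithinAt ℝ (Set.Icc 0 b) b := uniqueDiffOn_Icc hb b hbm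
  have hG : HasDerivWithinAt (fun τ => ∫ t in (0:ℝ)..τ, g t) (g b) (Set.Icc 0 b) b := by
    have : Fact (b ∈ Set.Icc 0 b) := ⟨hbm⟩
    refine intervalIntegral.integral_hasDerivWithinAt_right
      (hg.intervalIntegrable_of_Icc hb.le) ?_ (hg b hbm)
    exact hg.stronglyMeasurableAtFilter_nhdsWithin measurableSet_Icc b
  refine hud.eq_deriv _ hG ?_
  set K := ∫ t in (0:ℝ)..b, v t with hK
  have key : ∀ τ ∈ Set.Icc (0:ℝ) b,
      (∫ t in (0:ℝ)..τ, g t) - (∫ t in (0:ℝ)..b, g t) - (τ - b) • (K + c)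
        = - ∫ t in τ..b, (τ - t) * v t := by
    intro τ hτ
    have i1 : ∀ d, IntervalIntegrable (fun t => (d - t) * v t) volume 0 b := fun d =>
      hv.continuousOn_mul (by fun_prop)
    have e1 : (∫ t in (0:ℝ)..b, (b - t) * v t) - ∫ t in (0:ℝ)..b, (τ - t) * v t
        = (b - τ) * K := by
      rw [← intervalIntegral.integral_sub (i1 b) (i1 τ), hK,
        ← intervalIntegral.integral_const_mul]
      congr 1; ext t; ring
    have e2 : (∫ t in (0:ℝ)..τ, (τ - t) * v t) + ∫ t in τ..b, (τ - t) * v t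
        = ∫ t in (0:ℝ)..b, (τ - t) * v t := by
      have hs : τ ∈ Set.uIcc 0 b := by rwa [Set.uIcc_of_le hb.le]
      exact intervalIntegral.integral_add_adjacent_intervals
        ((i1 τ).mono_set (Set.uIcc_subset_uIcc_left hs))
        ((i1 τ).mono_set (Set.uIcc_subset_uIcc_right hs))
    rw [h τ hτ, h b hbm, smul_eq_mul]
    linarith
  have hsmall : Filter.Tendsto (fun τ => ∫ t in τ..b, |v t|) (nhdsWithin b (Set.Icc 0 b))
      (nhds 0) := by
    have hc := (intervalIntegral.continuousOn_primitive_interval_left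
      (f := fun t => |v t|) (μ := volume) (a := 0) (b := b)
      (by
        rw [Set.uIcc_of_le hb.le, integrableOn_Icc_iff_integrableOn_Ioc]
        exact ((intervalIntegrable_iff_integrableOn_Ioc_of_le hb.le).1 hv).abs))
    rw [Set.uIcc_of_le hb.le] at hc
    simpa [ContinuousWithinAt] using hc b hbm
  rw [hasDerivWithinAt_iff_isLittleO]
  have hO : (fun τ => (∫ t in (0:ℝ)..τ, g t) - (∫ t in (0:ℝ)..b, g t) - (τ - b) • (K + c))
      =O[nhdsWithin b (Set.Icc 0 b)] fun τ => (∫ t in τ..b, |v t|) * (τ - b) := by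
    refine Asymptotics.IsBigO.of_bound 1 ?_
    filter_upwards [self_mem_nhdsWithin] with τ hτ
    have hvτ : IntervalIntegrable v volume τ b := hv.mono_set
      (Set.uIcc_subset_uIcc_right (by rwa [Set.uIcc_of_le hb.le]))
    rw [key τ hτ, norm_neg, one_mul, norm_mul]
    calc ‖∫ t in τ..b, (τ - t) * v t‖ ≤ ∫ t in τ..b, (b - τ) * |v t| := by
          refine intervalIntegral.norm_integral_le_of_norm_le hτ.2 ?_ (hvτ.abs.const_mul _)
          refine Filter.Eventually.of_forall fun t ht => ?_
          rw [norm_mul, Real.norm_eq_abs, Real.norm_eq_abs]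
          refine mul_le_mul_of_nonneg_right ?_ (abs_nonneg _)
          rw [abs_le]; constructor <;> linarith [ht.1, ht.2]
      _ = (∫ t in τ..b, |v t|) * (b - τ) := by
          rw [intervalIntegral.integral_const_mul, mul_comm]
      _ ≤ ‖∫ t in τ..b, |v t|‖ * ‖τ - b‖ := by
          refine mul_le_mul (le_abs_self _) ?_ (by linarith [hτ.2]) (norm_nonneg _)
          rw [Real.norm_eq_abs, abs_sub_comm]; exact le_abs_self _
  refine hO.trans_isLittleO ?_
  simpa using ((Asymptotics.isLittleO_one_iff ℝ).2 hsmall).mul_isBigO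
    (Asymptotics.isBigO_refl (fun τ => τ - b) (nhdsWithin b (Set.Icc 0 b)))

/-- Integrating a family that is continuous in `L¹` against a bounded continuous moving profile
gives a continuous function of time. -/
lemma continuousOn_integral_mul_comp_sub {ρ : ℝ → ℝ → ℝ} {T : ℝ} {ψ X : ℝ → ℝ}
    (hint : ∀ t ∈ Set.Icc (0:ℝ) T, IntegrableOn (ρ t) (Set.Ioc 0 1))
    (hcont : ∀ t ∈ Set.Icc (0:ℝ) T, ∀ ε > (0:ℝ), ∃ η > (0:ℝ), ∀ s ∈ Set.Icc (0:ℝ) T,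
      |s - t| < η → (∫ x in Set.Ioc (0:ℝ) 1, |ρ s x - ρ t x|) < ε)
    (hψ : Continuous ψ) (hψ1 : ∀ y, |ψ y| ≤ 1) (hX : Continuous X) :
    ContinuousOn (fun t => ∫ x in Set.Ioc (0:ℝ) 1, ρ t x * ψ (x - X t)) (Set.Icc 0 T) := by
  have hmul : ∀ t ∈ Set.Icc (0:ℝ) T, ∀ s,
      IntegrableOn (fun x => ρ t x * ψ (x - X s)) (Set.Ioc 0 1) := by
    intro t ht s
    refine (hint t ht).mul_bdd (c := 1) ?_ ?_
    · exact (by fun_prop : Continuous fun x => ψ (x - X s)).aestronglyMeasurable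
    · exact Filter.Eventually.of_forall fun x => hψ1 _
  intro t ht
  have h1 : Filter.Tendsto (fun s => ∫ x in Set.Ioc (0:ℝ) 1, ρ t x * ψ (x - X s))
      (nhdsWithin t (Set.Icc 0 T)) (nhds (∫ x in Set.Ioc (0:ℝ) 1, ρ t x * ψ (x - X t))) := by
    refine tendsto_integral_filter_of_dominated_convergence (fun x => |ρ t x|) ?_ ?_ ?_ ?_
    · exact Filter.Eventually.of_forall fun s => (hmul t ht s).aestronglyMeasurable
    · refine Filter.Eventually.of_forall fun s => Filter.Eventually.of_forall fun x => ?_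
      rw [norm_mul]
      exact mul_le_of_le_one_right (norm_nonneg _) (hψ1 _)
    · exact (hint t ht).abs
    · refine Filter.Eventually.of_forall fun x => ?_
      exact (by fun_prop : Continuous fun s => ρ t x * ψ (x - X s)).continuousWithinAt
  have h2 : Filter.Tendsto (fun s => ∫ x in Set.Ioc (0:ℝ) 1, (ρ s x - ρ t x) * ψ (x - X s))
      (nhdsWithin t (Set.Icc 0 T)) (nhds 0) := by
    have h3 : Filter.Tendsto (fun s => ∫ x in Set.Ioc (0:ℝ) 1, |ρ s x - ρ t x|)
        (nhdsWithin t (Set.Icc 0 T)) (nhds 0) := by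
      rw [Metric.tendsto_nhdsWithin_nhds]
      intro ε hε
      obtain ⟨η, hη, H⟩ := hcont t ht ε hε
      refine ⟨η, hη, fun s hs hst => ?_⟩
      rw [Real.dist_eq, sub_zero, abs_of_nonneg (integral_nonneg fun x => abs_nonneg _)]
      exact H s hs hst
    refine squeeze_zero_norm' ?_ h3
    filter_upwards [self_mem_nhdsWithin] with s hs
    refine norm_integral_le_of_norm_le ((hint s hs).sub (hint t ht)).abs ?_
    refine Filter.Eventually.of_forall fun x => ?_
    rw [norm_mul]
    exact mul_le_of_le_one_right (norm_nonneg _) (hψ1 _)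
  have h4 := h1.add h2
  rw [add_zero] at h4
  refine h4.congr' ?_
  filter_upwards [self_mem_nhdsWithin] with s hs
  rw [← integral_add (hmul t ht s)]
  · congr 1; ext x; ring
  · refine ((hmul s hs s).sub (hmul t ht s)).congr (Filter.Eventually.of_forall fun x => ?_)
    simp only [Pi.sub_apply]; ring

/-- Representation of a weak solution tested against a profile transported along the
characteristics of speed `X'` that stays supported in `x < 1`. -/
lemma IsWeakSolution.integral_mul_comp_sub_eq {lam : ℝ → ℝ} {T : ℝ} {ρ₀ u : ℝ → ℝ}
    {ρ : ℝ → ℝ → ℝ} (hρ : IsWeakSolution lam T ρ₀ u ρ) (hu : IntegrableOn u (Set.Ioc 0 T))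
    {X L : ℝ → ℝ} (hL : Continuous L) (hX : ∀ t, HasDerivAt X (L t) t) (hX0 : X 0 = 0)
    (hLlam : ∀ t ∈ Set.Icc (0:ℝ) T, L t = lam (∫ y in Set.Ioc (0:ℝ) 1, ρ t y))
    {b : ℝ} (hb : 0 < b) (hbT : b ≤ T) (hmono : ∀ t ∈ Set.Icc (0:ℝ) b, X t ≤ X b)
    {ψ : ℝ → ℝ} (hψ : ContDiff ℝ 1 ψ) (hψ1 : ∀ y, |ψ y| ≤ 1) (hψ0 : ∀ y, 1 - X b ≤ y → ψ y = 0) :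
    ∫ x in Set.Ioc (0:ℝ) 1, ρ b x * ψ (x - X b)
      = (∫ t in (0:ℝ)..b, u t * ψ (-X t)) + ∫ x in Set.Ioc (0:ℝ) 1, ρ₀ x * ψ x := by
  obtain ⟨hint, hcont, hweak⟩ := hρ
  have hdX : deriv X = L := funext fun t => (hX t).deriv
  have hXd : ContDiff ℝ 1 X := contDiff_one_iff_deriv.2
    ⟨fun t => (hX t).differentiableAt, by rwa [hdX]⟩
  have hub : IntervalIntegrable u volume 0 b :=
    (intervalIntegrable_iff_integrableOn_Ioc_of_le hb.le).2
      (hu.mono_set (Set.Ioc_subset_Ioc_right hbT))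
  have hXc := hXd.continuous
  have hψc := hψ.continuous
  refine eq_integral_add_of_forall_integral_eq
    (g := fun t => ∫ x in Set.Ioc (0:ℝ) 1, ρ t x * ψ (x - X t)) hb
    ((continuousOn_integral_mul_comp_sub hint hcont hψc hψ1 hXc).mono
      (Set.Icc_subset_Icc_right hbT))
    (hub.mul_continuousOn (by fun_prop)) ?_
  intro τ hτ
  have hτT : τ ∈ Set.Icc 0 T := ⟨hτ.1, hτ.2.trans hbT⟩
  have hw := hweak τ hτT (fun t x => (τ - t) * ψ (x - X t)) (by
      unfold Function.uncurry; fun_prop) (by simp) (by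
      intro t ht
      rw [hψ0, mul_zero]
      linarith [hmono t ⟨ht.1, ht.2.trans hτ.2⟩])
  have hψd : ∀ y, HasDerivAt ψ (deriv ψ y) y := fun y =>
    (hψ.differentiable (by norm_num) y).hasDerivAt
  have hinner : ∀ t ∈ Set.Ioc (0:ℝ) τ,
      (∫ x in Set.Ioc (0:ℝ) 1, ρ t x * (deriv (fun s => (τ - s) * ψ (x - X s)) t
        + lam (∫ y in Set.Ioc (0:ℝ) 1, ρ t y) * deriv (fun x => (τ - t) * ψ (x - X t)) x))
      = -∫ x in Set.Ioc (0:ℝ) 1, ρ t x * ψ (x - X t) := by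
    intro t ht
    rw [← MeasureTheory.integral_neg]
    congr 1; ext x
    have d1 : HasDerivAt (fun s => (τ - s) * ψ (x - X s))
        (-1 * ψ (x - X t) + (τ - t) * (deriv ψ (x - X t) * (-L t))) t :=
      ((hasDerivAt_id' t).const_sub τ).mul
        ((hψd (x - X t)).comp t ((hX t).const_sub x))
    have d2 : HasDerivAt (fun x => (τ - t) * ψ (x - X t))
        ((τ - t) * (deriv ψ (x - X t) * 1)) x :=
      ((hψd (x - X t)).comp x ((hasDerivAt_id' x).sub_const (X t))).const_mul _
    rw [d1.deriv, d2.deriv, ← hLlam t ⟨ht.1.le, ht.2.trans hτT.2⟩]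
    ring
  rw [setIntegral_congr_fun measurableSet_Ioc hinner, MeasureTheory.integral_neg] at hw
  have e2 : (∫ x in Set.Ioc (0:ℝ) 1, ρ₀ x * ((τ - 0) * ψ (x - X 0)))
      = τ * ∫ x in Set.Ioc (0:ℝ) 1, ρ₀ x * ψ x := by
    rw [← MeasureTheory.integral_const_mul]
    congr 1; ext x; rw [hX0, sub_zero, sub_zero]; ring
  rw [e2] at hw
  rw [intervalIntegral.integral_of_le hτ.1, intervalIntegral.integral_of_le hτ.1]
  have e3 : (∫ t in Set.Ioc (0:ℝ) τ, u t * ((τ - t) * ψ (0 - X t)))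
      = ∫ t in Set.Ioc (0:ℝ) τ, (τ - t) * (u t * ψ (-X t)) := by
    congr 1; ext t; rw [zero_sub]; ring
  rw [e3] at hw
  linarith

/-- Smooth steps increasing to the indicator of a half-line, tested against an integrable
function. -/
lemma tendsto_integral_mul_smoothTransition {f X : ℝ → ℝ} {s : Set ℝ}
    (hf : IntegrableOn f s) (hX : Continuous X) (c : ℝ) :
    Filter.Tendsto (fun n : ℕ => ∫ x in s, f x * Real.smoothTransition (n * (c - X x)))
      Filter.atTop (nhds (∫ x in s ∩ {x | X x < c}, f x)) := by
  have hm : MeasurableSet {x | X x < c} := measurableSet_lt hX.measurable measurable_const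
  rw [← setIntegral_indicator hm]
  refine tendsto_integral_of_dominated_convergence (fun x => |f x|) ?_ hf.abs ?_ ?_
  · intro n
    exact hf.aestronglyMeasurable.mul (by
      have := Real.smoothTransition.continuous
      exact (by fun_prop : Continuous fun x =>
        Real.smoothTransition (n * (c - X x))).aestronglyMeasurable)
  · intro n
    refine Filter.Eventually.of_forall fun x => ?_
    rw [norm_mul]
    refine mul_le_of_le_one_right (norm_nonneg _) ?_
    rw [Real.norm_eq_abs, abs_of_nonneg (Real.smoothTransition.nonneg _)]
    exact Real.smoothTransition.le_one _
  · refine Filter.Eventually.of_forall fun x => ?_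
    by_cases hx : X x < c
    · rw [Set.indicator_of_mem (show x ∈ {x | X x < c} from hx)]
      refine tendsto_const_nhds.congr' ?_
      obtain ⟨N, hN⟩ := exists_nat_ge (1 / (c - X x))
      filter_upwards [Filter.eventually_ge_atTop N] with n hn
      rw [Real.smoothTransition.one_of_one_le, mul_one]
      have hp : 0 < c - X x := by linarith
      rw [← div_le_iff₀ hp]
      exact hN.trans (by exact_mod_cast hn)
    · rw [Set.indicator_of_notMem (show x ∉ {x | X x < c} from hx)]
      refine tendsto_const_nhds.congr fun n => ?_
      rw [Real.smoothTransition.zero_of_nonpos, mul_zero]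
      exact mul_nonpos_of_nonneg_of_nonpos (Nat.cast_nonneg n) (by linarith)

/-- The mass of a weak solution at a positive time, in terms of the data carried by the
characteristics that have not left the domain. -/
lemma IsWeakSolution.integral_eq {lam : ℝ → ℝ} {T : ℝ} {ρ₀ u : ℝ → ℝ}
    {ρ : ℝ → ℝ → ℝ} (hρ : IsWeakSolution lam T ρ₀ u ρ) (hu : IntegrableOn u (Set.Ioc 0 T))
    (hρ₀ : IntegrableOn ρ₀ (Set.Ioc 0 1))
    {X L : ℝ → ℝ} (hL : Continuous L) (hX : ∀ t, HasDerivAt X (L t) t) (hX0 : X 0 = 0)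
    (hLlam : ∀ t ∈ Set.Icc (0:ℝ) T, L t = lam (∫ y in Set.Ioc (0:ℝ) 1, ρ t y))
    {b : ℝ} (hb : 0 < b) (hbT : b ≤ T) (hmono : ∀ t ∈ Set.Icc (0:ℝ) b, X t ≤ X b) :
    ∫ x in Set.Ioc (0:ℝ) 1, ρ b x
      = (∫ t in Set.Ioc 0 b ∩ {t | -X t < 1 - X b}, u t)
        + ∫ x in Set.Ioc (0:ℝ) 1 ∩ {x | x < 1 - X b}, ρ₀ x := by
  have hXc : Continuous X := continuous_iff_continuousAt.2 fun t => (hX t).continuousAt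
  have t1 := tendsto_integral_mul_smoothTransition
    (hρ.1 b ⟨hb.le, hbT⟩) (continuous_id.sub (continuous_const (y := X b))) (1 - X b)
  have t2 := tendsto_integral_mul_smoothTransition
    (hu.mono_set (Set.Ioc_subset_Ioc_right hbT)) hXc.neg (1 - X b)
  have t3 := tendsto_integral_mul_smoothTransition hρ₀ continuous_id (1 - X b)
  have hs : (Set.Ioc (0:ℝ) 1 ∩ {x | x - X b < 1 - X b}) = Set.Ioo 0 1 := by
    ext x; simp only [Set.mem_inter_iff, Set.mem_Ioc, Set.mem_ofPred_eq, Set.mem_Ioo]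
    grind
  have t1' : Filter.Tendsto (fun n : ℕ => ∫ x in Set.Ioc (0:ℝ) 1,
      ρ b x * Real.smoothTransition (n * (1 - X b - (x - X b)))) Filter.atTop
      (nhds (∫ x in Set.Ioc (0:ℝ) 1, ρ b x)) := by
    rw [integral_Ioc_eq_integral_Ioo, ← hs]; exact t1
  refine tendsto_nhds_unique t1' ((t2.add t3).congr fun n => ?_)
  have h := hρ.integral_mul_comp_sub_eq hu hL hX hX0 hLlam hb hbT hmono
    (ψ := fun y => Real.smoothTransition (n * (1 - X b - y)))
    (Real.smoothTransition.contDiff.comp (by fun_prop))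
    (fun y => by
      rw [abs_of_nonneg (Real.smoothTransition.nonneg _)]
      exact Real.smoothTransition.le_one _)
    (fun y hy => Real.smoothTransition.zero_of_nonpos
      (mul_nonpos_of_nonneg_of_nonpos (Nat.cast_nonneg n) (by linarith)))
  rw [h, intervalIntegral.integral_of_le hb.le]
  rfl

/-- Remark 2.5 (global formula for the total mass): `W(t) = ∫₀ᵗ u + ∫₀^{1-ξ(t)} ρ₀`
when `ξ(t) ≤ 1`, and `W(t) = ∫_{ξ⁻¹(ξ(t)-1)}^{t} u` when `ξ(t) ≥ 1`; moreover
`0 ≤ W(t) ≤ M` and `0 < λ̃(M) ≤ ξ'(t) = λ(W(t)) ≤ λ̄(M)` on `[0,T]`. -/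
theorem global_mass_formula
    (lam : ℝ → ℝ) (hlam : ContDiff ℝ 1 lam) (hlam_pos : ∀ w, 0 < lam w)
    (T : ℝ) (hT : 0 < T) (ρ₀ u : ℝ → ℝ)
    (hρ₀ : MeasureTheory.IntegrableOn ρ₀ (Set.Ioc 0 1))
    (hu : MeasureTheory.IntegrableOn u (Set.Ioc 0 T))
    (hρ₀nn : ∀ᵐ x ∂(volume.restrict (Set.Ioc (0:ℝ) 1)), 0 ≤ ρ₀ x)
    (hunn : ∀ᵐ t ∂(volume.restrict (Set.Ioc (0:ℝ) T)), 0 ≤ u t)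
    (M : ℝ) (hM : M = (∫ t in (0:ℝ)..T, |u t|) + ∫ x in (0:ℝ)..1, |ρ₀ x|)
    (ρ : ℝ → ℝ → ℝ) (hρ : IsWeakSolution lam T ρ₀ u ρ)
    (W : ℝ → ℝ) (hW : ∀ t, W t = ∫ x in Set.Ioc (0:ℝ) 1, ρ t x)
    (ξ : ℝ → ℝ) (hξ0 : ξ 0 = 0)
    (hξ : ∀ t ∈ Set.Icc (0:ℝ) T, HasDerivWithinAt ξ (lam (W t)) (Set.Icc 0 T) t) :
    (∀ t ∈ Set.Icc (0:ℝ) T, ξ t ≤ 1 →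
        W t = (∫ σ in (0:ℝ)..t, u σ) + ∫ y in (0:ℝ)..(1 - ξ t), ρ₀ y) ∧
    (∀ t ∈ Set.Icc (0:ℝ) T, 1 ≤ ξ t →
        ∀ s ∈ Set.Icc (0:ℝ) T, ξ s = ξ t - 1 → W t = ∫ σ in s..t, u σ) ∧
    (∀ t ∈ Set.Icc (0:ℝ) T,
        0 ≤ W t ∧ W t ≤ M ∧ 0 < lamInf lam M ∧
        lamInf lam M ≤ lam (W t) ∧ lam (W t) ≤ lamSup lam M) := by
  have hWc : ContinuousOn W (Set.Icc 0 T) := by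
    simpa [← hW] using continuousOn_integral_mul_comp_sub hρ.1 hρ.2.1
      (ψ := fun _ => 1) (X := fun _ => 0) (by fun_prop) (by simp) (by fun_prop)
  obtain ⟨L, hLc, hLpos, hLeq⟩ : ∃ L : ℝ → ℝ, Continuous L ∧ (∀ t, 0 < L t) ∧
      ∀ t ∈ Set.Icc (0:ℝ) T, L t = lam (W t) := by
    refine ⟨Set.IccExtend hT.le (fun s => lam (W s)), ?_, fun t => hlam_pos _, fun t ht => ?_⟩
    · exact (hlam.continuous.comp (continuousOn_iff_continuous_domRestrict.1 hWc)).Icc_extend'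
    · rw [Set.IccExtend_of_mem _ _ ht]
  obtain ⟨X, hX, hX0⟩ : ∃ X : ℝ → ℝ, (∀ t, HasDerivAt X (L t) t) ∧ X 0 = 0 :=
    ⟨fun t => ∫ s in (0:ℝ)..t, L s, fun t => hLc.integral_hasStrictDerivAt 0 t |>.hasDerivAt,
      by simp⟩
  have hXc : Continuous X := continuous_iff_continuousAt.2 fun t => (hX t).continuousAt
  have hXmono : StrictMono X := strictMono_of_deriv_pos fun t => by
    rw [(hX t).deriv]; exact hLpos t
  have hξX : ∀ t ∈ Set.Icc (0:ℝ) T, ξ t = X t := by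
    refine eq_of_has_deriv_right_eq (f' := L) (fun t ht => ?_)
      (fun t _ => (hX t).hasDerivWithinAt) (fun t ht => (hξ t ht).continuousWithinAt)
      hXc.continuousOn (by rw [hξ0, hX0])
    have ht' : t ∈ Set.Icc (0:ℝ) T := ⟨ht.1, ht.2.le⟩
    rw [hLeq t ht']
    exact (hξ t ht').mono_of_mem_nhdsWithin (Icc_mem_nhdsGE_of_mem ht)
  have hmass : ∀ b ∈ Set.Ioc (0:ℝ) T, W b
      = (∫ t in Set.Ioc 0 b ∩ {t | -X t < 1 - X b}, u t)
        + ∫ x in Set.Ioc (0:ℝ) 1 ∩ {x | x < 1 - X b}, ρ₀ x := fun b hb => by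
    rw [hW]
    exact hρ.integral_eq hu hρ₀ hLc hX hX0 (fun t ht => by rw [hLeq t ht, hW]) hb.1 hb.2
      fun t ht => hXmono.monotone ht.2
  have hXnn : ∀ t, 0 ≤ t → 0 ≤ X t := fun t ht => hX0 ▸ hXmono.monotone ht
  have early : ∀ b ∈ Set.Ioc (0:ℝ) T, X b ≤ 1 →
      W b = (∫ σ in (0:ℝ)..b, u σ) + ∫ y in (0:ℝ)..(1 - X b), ρ₀ y := by
    intro b hb hb1
    have hs1 : Set.Ioc 0 b ∩ {t | -X t < 1 - X b} = Set.Ioc 0 b := by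
      refine Set.inter_eq_left.2 fun t ht => ?_
      have : X 0 < X t := hXmono ht.1
      show -X t < 1 - X b
      linarith
    have hs2 : Set.Ioc (0:ℝ) 1 ∩ {x | x < 1 - X b} = Set.Ioo 0 (1 - X b) := by
      have := hXnn b hb.1.le
      ext x
      simp only [Set.mem_inter_iff, Set.mem_Ioc, Set.mem_ofPred_eq, Set.mem_Ioo]
      grind
    rw [hmass b hb, hs1, hs2, intervalIntegral.integral_of_le hb.1.le,
      intervalIntegral.integral_of_le (by linarith), integral_Ioc_eq_integral_Ioo (y := 1 - X b)]
  have early' : ∀ b ∈ Set.Icc (0:ℝ) T, X b ≤ 1 →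
      W b = (∫ σ in (0:ℝ)..b, u σ) + ∫ y in (0:ℝ)..(1 - X b), ρ₀ y := by
    intro b hb hb1
    rcases hb.1.eq_or_lt with rfl | hb0
    · obtain ⟨δ, hδ1, hδ⟩ : ∃ δ, X δ < 1 ∧ δ ∈ Set.Ioc 0 T := by
        have h1 : ∀ᶠ t in nhdsWithin 0 (Set.Ioi 0), X t < 1 :=
          (hXc.tendsto 0).mono_left nhdsWithin_le_nhds |>.eventually_lt_const (by simp [hX0])
        exact (h1.and (Ioc_mem_nhdsGT hT)).exists
      have hsub : Set.Icc 0 δ ⊆ Set.Icc 0 T := Set.Icc_subset_Icc_right hδ.2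
      have hEq : Set.EqOn W
          (fun b => (∫ σ in (0:ℝ)..b, u σ) + ∫ y in (0:ℝ)..(1 - X b), ρ₀ y) (Set.Ioc 0 δ) :=
        fun t ht => early t ⟨ht.1, ht.2.trans hδ.2⟩ ((hXmono.monotone ht.2).trans hδ1.le)
      refine hEq.of_subset_closure (hWc.mono hsub) (ContinuousOn.add ?_ ?_)
        Set.Ioc_subset_Icc_self (by rw [closure_Ioc hδ.1.ne]) ⟨le_rfl, hδ.1.le⟩
      · refine (intervalIntegral.continuousOn_primitive_interval (a := 0) (b := T) ?_).mono ?_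
        · rwa [Set.uIcc_of_le hT.le, integrableOn_Icc_iff_integrableOn_Ioc]
        · rwa [Set.uIcc_of_le hT.le]
      · refine (intervalIntegral.continuousOn_primitive_interval (f := ρ₀) (μ := volume)
          (a := 0) (b := 1) ?_).comp
          (by fun_prop : Continuous fun t => 1 - X t).continuousOn fun t ht => ?_
        · rwa [Set.uIcc_of_le zero_le_one, integrableOn_Icc_iff_integrableOn_Ioc]
        · rw [Set.uIcc_of_le zero_le_one]
          have := hXnn t ht.1
          have := hXmono.monotone ht.2
          constructor <;> linarith
    · exact early b ⟨hb0, hb.2⟩ hb1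
  have late : ∀ t ∈ Set.Icc (0:ℝ) T, 1 ≤ X t →
      ∀ s ∈ Set.Icc (0:ℝ) T, X s = X t - 1 → W t = ∫ σ in s..t, u σ := by
    intro t ht ht1 s hs hst
    have ht0 : 0 < t := hXmono.lt_iff_lt.1 (by linarith)
    have hslt : s < t := hXmono.lt_iff_lt.1 (by linarith)
    have hs1 : Set.Ioc 0 t ∩ {r | -X r < 1 - X t} = Set.Ioc s t := by
      ext r
      have h : -X r < 1 - X t ↔ s < r := by
        rw [← hXmono.lt_iff_lt (a := s), hst]; constructor <;> intro <;> linarith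
      have := hs.1
      simp only [Set.mem_inter_iff, Set.mem_Ioc, Set.mem_ofPred_eq, h]
      grind
    have hs2 : Set.Ioc (0:ℝ) 1 ∩ {x | x < 1 - X t} = ∅ := by
      ext x
      simp only [Set.mem_inter_iff, Set.mem_Ioc, Set.mem_ofPred_eq, Set.mem_empty_iff_false]
      grind
    rw [hmass t ⟨ht0, ht.2⟩, hs1, hs2, intervalIntegral.integral_of_le hslt.le]
    simp
  have hui : IntervalIntegrable u volume 0 T :=
    (intervalIntegrable_iff_integrableOn_Ioc_of_le hT.le).2 hu
  have hρi : IntervalIntegrable ρ₀ volume 0 1 :=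
    (intervalIntegrable_iff_integrableOn_Ioc_of_le zero_le_one).2 hρ₀
  have bound : ∀ {f : ℝ → ℝ} {d : ℝ}, IntervalIntegrable f volume 0 d →
      (∀ᵐ x ∂(volume.restrict (Set.Ioc (0:ℝ) d)), 0 ≤ f x) → ∀ a b, 0 ≤ a → a ≤ b → b ≤ d →
      0 ≤ (∫ x in a..b, f x) ∧ (∫ x in a..b, f x) ≤ ∫ x in (0:ℝ)..d, |f x| := by
    intro f d hf hnn a b ha hab hbd
    have h0 : (∫ x in (0:ℝ)..d, |f x|) = ∫ x in (0:ℝ)..d, f x := by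
      rw [intervalIntegral.integral_of_le (by linarith),
        intervalIntegral.integral_of_le (by linarith)]
      refine integral_congr_ae ?_
      filter_upwards [hnn] with x hx using abs_of_nonneg hx
    rw [h0]
    refine ⟨?_, intervalIntegral.integral_mono_interval ha hab hbd hnn hf⟩
    rw [intervalIntegral.integral_of_le hab]
    exact integral_nonneg_of_ae
      (ae_restrict_of_ae_restrict_of_subset (Set.Ioc_subset_Ioc ha hbd) hnn)
  have hWb : ∀ t ∈ Set.Icc (0:ℝ) T, 0 ≤ W t ∧ W t ≤ M := by
    intro t ht
    have hρ0 := bound hρi hρ₀nn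
    have hu0 := bound hui hunn
    rcases le_total (X t) 1 with h | h
    · have a1 := hu0 0 t le_rfl ht.1 ht.2
      have a2 := hρ0 0 (1 - X t) le_rfl (by linarith) (by linarith [hXnn t ht.1])
      rw [early' t ht h, hM]
      constructor <;> linarith [a1.1, a1.2, a2.1, a2.2]
    · obtain ⟨s, hs, hst⟩ := intermediate_value_Icc ht.1 hXc.continuousOn
        (show X t - 1 ∈ Set.Icc (X 0) (X t) by rw [hX0]; constructor <;> linarith)
      have a1 := hu0 s t hs.1 hs.2 ht.2
      have a2 := hρ0 0 0 le_rfl le_rfl zero_le_one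
      rw [late t ht h s ⟨hs.1, hs.2.trans ht.2⟩ hst, hM]
      constructor <;> linarith [a1.1, a1.2, a2.1, a2.2]
  refine ⟨fun t ht h => ?_, fun t ht h s hs hst => ?_, fun t ht => ?_⟩
  · rw [hξX t ht] at h ⊢
    exact early' t ht h
  · rw [hξX t ht] at h hst
    rw [hξX s hs] at hst
    exact late t ht h s hs hst
  · obtain ⟨h0, hM'⟩ := hWb t ht
    have hcpt : IsCompact (lam '' Set.Icc 0 M) := isCompact_Icc.image hlam.continuous
    have hmem : lam (W t) ∈ lam '' Set.Icc 0 M := Set.mem_image_of_mem _ ⟨h0, hM'⟩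
    refine ⟨h0, hM', ?_, csInf_le hcpt.bddBelow hmem, le_csSup hcpt.bddAbove hmem⟩
    obtain ⟨w, _, hw⟩ := hcpt.sInf_mem ⟨_, hmem⟩
    rw [lamInf, ← hw]
    exact hlam_pos w
end
end

section
/- (Hidden regularity.) Let ρ0∈L¹(0,1) and u∈L¹(0,T) be nonnegative a.e., and let ρ be the unique weak solution of the Cauchy problem. Then ρ∈C⁰([0,1];L¹(0,T)): the map x ↦ ρ(·,x) is a continuous function from [0,1] into L¹(0,T); in particular, for every fixed x∈[0,1] the trace t ↦ ρ(t,x) is a well-defined element of L¹(0,T). -/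
open MeasureTheory Set intervalIntegral

noncomputable section

open Filter Topology

/-- A sequence of uniformly Lipschitz functions vanishing at the origin has a pointwise
convergent subsequence. -/
theorem exists_subseq_tendsto_of_lipschitzWith {K : NNReal} {f : ℕ → ℝ → ℝ}
    (hf : ∀ n, LipschitzWith K (f n)) (h0 : ∀ n, f n 0 = 0) :
    ∃ (g : ℝ → ℝ) (φ : ℕ → ℕ), StrictMono φ ∧
      ∀ x, Tendsto (fun n => f (φ n) x) atTop (𝓝 (g x)) := by
  have hmem : ∀ n, (fun q : ℚ => f n q) ∈
      (univ.pi fun q : ℚ => Icc (-(K * |(q : ℝ)|)) (K * |(q : ℝ)|)) := by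
    intro n q _
    have := (hf n).dist_le_mul q 0
    rw [h0, Real.dist_eq, Real.dist_eq, sub_zero, sub_zero] at this
    exact abs_le.1 this
  obtain ⟨a, -, φ, hφ, ha⟩ :=
    (isCompact_univ_pi fun q : ℚ => isCompact_Icc (a := -(K * |(q : ℝ)|))
      (b := K * |(q : ℝ)|)).tendsto_subseq hmem
  have hq : ∀ q : ℚ, CauchySeq fun n => f (φ n) q := fun q =>
    (tendsto_pi_nhds.1 ha q).cauchySeq
  have hx : ∀ x : ℝ, ∃ y, Tendsto (fun n => f (φ n) x) atTop (𝓝 y) := by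
    intro x
    refine cauchySeq_tendsto_of_complete (Metric.cauchySeq_iff.2 fun ε hε => ?_)
    obtain ⟨q, hq1, hq2⟩ := exists_rat_btwn
      (show x < x + ε / (3 * (K + 1)) by linarith [show 0 < ε / (3 * ((K : ℝ) + 1)) by positivity])
    obtain ⟨N, hN⟩ := Metric.cauchySeq_iff.1 (hq q) (ε / 3) (by positivity)
    refine ⟨N, fun m hm n hn => ?_⟩
    have hclose : ∀ k, dist (f k x) (f k q) < ε / 3 := by
      intro k
      refine ((hf k).dist_le_mul x q).trans_lt ?_
      have hd : dist x q < ε / (3 * (K + 1)) := by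
        rw [dist_comm, Real.dist_eq, abs_of_pos (by linarith)]; linarith
      rw [lt_div_iff₀ (by positivity)] at hd
      nlinarith [dist_nonneg (x := x) (y := (q : ℝ)), K.coe_nonneg]
    have h1 := hclose (φ m)
    have h2 := hclose (φ n)
    have h3 := hN m hm n hn
    calc dist (f (φ m) x) (f (φ n) x)
        ≤ dist (f (φ m) x) (f (φ m) q) + dist (f (φ m) q) (f (φ n) q)
          + dist (f (φ n) q) (f (φ n) x) := dist_triangle4 _ _ _ _
      _ < ε := by rw [dist_comm (f (φ n) q)]; linarith
  choose g hg using hx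
  exact ⟨g, φ, hφ, hg⟩

theorem lipschitzWith_integral_of_continuous {K : NNReal} {v : ℝ → ℝ} (hv : Continuous v)
    (hK : ∀ s, ‖v s‖ ≤ K) : LipschitzWith K fun z => ∫ s in (0 : ℝ)..z, v s := by
  refine LipschitzWith.of_dist_le_mul fun x y => ?_
  rw [Real.dist_eq, integral_interval_sub_left (hv.intervalIntegrable _ _)
    (hv.intervalIntegrable _ _), ← Real.norm_eq_abs, Real.dist_eq]
  exact norm_integral_le_of_norm_le_const fun s _ => hK s

/-- Tonelli approximations: solutions of the equation with an additional delay `h`. -/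
theorem exists_tonelli_approximation {c U P : ℝ → ℝ} {K : NNReal} (hc : Continuous c)
    (hU : Continuous U) (hP : Continuous P) (hc0 : ∀ w, 0 < c w) (hcK : ∀ w, c w ≤ K)
    (hU0 : ∀ t ≤ 0, U t = 0) {h : ℝ} (hh : 0 < h) (hh1 : h ≤ 1) (n : ℕ) :
    ∃ σ : ℝ → ℝ, LipschitzWith K σ ∧ σ 0 = 0 ∧ ∀ z ≤ n * h,
      σ z = ∫ s in (0 : ℝ)..z, c (U (σ (s - h)) - U (σ (s - 1)) + P s) := by
  have hcK' : ∀ w, ‖c w‖ ≤ K := fun w => by rw [Real.norm_of_nonneg (hc0 w).le]; exact hcK w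
  induction n with
  | zero =>
    refine ⟨fun z => ∫ s in (0 : ℝ)..z, c (P s),
      lipschitzWith_integral_of_continuous (hc.comp hP) fun s => hcK' _, integral_same,
      fun z hz => ?_⟩
    have hz : z ≤ 0 := by simpa using hz
    have hneg : ∀ y ≤ 0, U (∫ s in (0 : ℝ)..y, c (P s)) = 0 := by
      intro y hy
      refine hU0 _ ?_
      rw [integral_symm, neg_nonpos]
      exact integral_nonneg hy fun s _ => (hc0 _).le
    refine integral_congr fun s hs => ?_
    rw [uIcc_of_ge hz] at hs
    simp only
    rw [hneg _ (by linarith [hs.2]), hneg _ (by linarith [hs.2]), sub_zero, zero_add]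
  | succ n ih =>
    obtain ⟨σ, hσ, -, hσe⟩ := ih
    have hcont : Continuous fun s => c (U (σ (s - h)) - U (σ (s - 1)) + P s) := by
      have := hσ.continuous
      fun_prop
    refine ⟨fun z => ∫ s in (0 : ℝ)..z, c (U (σ (s - h)) - U (σ (s - 1)) + P s),
      lipschitzWith_integral_of_continuous hcont fun s => hcK' _, integral_same,
      fun z hz => ?_⟩
    push_cast at hz
    refine integral_congr fun s hs => ?_
    have hs' : s ≤ (n + 1) * h := by
      rw [mem_uIcc] at hs
      have : 0 ≤ (n + 1) * h := by positivity
      rcases hs with hs | hs <;> linarith [hs.2]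
    simp only
    rw [← hσe (s - h) (by linarith), ← hσe (s - 1) (by linarith)]

/-- Existence for a scalar delay equation with merely continuous right-hand side. -/
theorem exists_delay_solution {c U P : ℝ → ℝ} {K : NNReal} (hc : Continuous c)
    (hU : Continuous U) (hP : Continuous P) (hc0 : ∀ w, 0 < c w) (hcK : ∀ w, c w ≤ K)
    (hU0 : ∀ t ≤ 0, U t = 0) :
    ∃ τ : ℝ → ℝ, τ 0 = 0 ∧
      ∀ z, HasDerivAt τ (c (U (τ z) - U (τ (z - 1)) + P z)) z := by
  have hcK' : ∀ w, ‖c w‖ ≤ K := fun w => by rw [Real.norm_of_nonneg (hc0 w).le]; exact hcK w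
  have hstep : ∀ n : ℕ, (0 : ℝ) < 1 / (n + 1) := fun n => by positivity
  have hstep1 : ∀ n : ℕ, (1 : ℝ) / (n + 1) ≤ 1 := fun n => by
    rw [div_le_one (by positivity)]; linarith [n.cast_nonneg (α := ℝ)]
  choose f hfL hf0 hfe using fun n : ℕ =>
    exists_tonelli_approximation hc hU hP hc0 hcK hU0 (hstep n) (hstep1 n) ((n + 1) * (n + 1))
  obtain ⟨τ, φ, hφ, hτ⟩ := exists_subseq_tendsto_of_lipschitzWith hfL hf0
  have hτL : LipschitzWith K τ := LipschitzWith.of_dist_le_mul fun x y =>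
    le_of_tendsto ((hτ x).dist (hτ y)) (Eventually.of_forall fun n => (hfL _).dist_le_mul x y)
  have hτdelay : ∀ s, Tendsto (fun n => f (φ n) (s - 1 / ((φ n : ℝ) + 1))) atTop (𝓝 (τ s)) := by
    intro s
    have hz : Tendsto (fun n => (K : ℝ) * (1 / ((φ n : ℝ) + 1))) atTop (𝓝 0) := by
      simpa using (tendsto_one_div_add_atTop_nhds_zero_nat.comp hφ.tendsto_atTop).const_mul (K : ℝ)
    refine (hτ s).congr_dist (squeeze_zero (fun _ => dist_nonneg) (fun n => ?_) hz)
    refine ((hfL _).dist_le_mul _ _).trans_eq ?_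
    rw [Real.dist_eq, sub_sub_cancel, abs_of_pos (hstep _)]
  have hcont : Continuous fun s => c (U (τ s) - U (τ (s - 1)) + P s) := by
    have := hτL.continuous
    fun_prop
  have hint : ∀ z, τ z = ∫ s in (0 : ℝ)..z, c (U (τ s) - U (τ (s - 1)) + P s) := by
    intro z
    refine tendsto_nhds_unique (hτ z) ?_
    have hlim : Tendsto (fun n => ∫ s in (0 : ℝ)..z,
        c (U (f (φ n) (s - 1 / ((φ n : ℝ) + 1))) - U (f (φ n) (s - 1)) + P s)) atTop
        (𝓝 (∫ s in (0 : ℝ)..z, c (U (τ s) - U (τ (s - 1)) + P s))) := by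
      refine tendsto_integral_filter_of_dominated_convergence (fun _ => (K : ℝ)) ?_ ?_ ?_ ?_
      · refine Eventually.of_forall fun n => Continuous.aestronglyMeasurable ?_
        have := (hfL (φ n)).continuous
        fun_prop
      · exact Eventually.of_forall fun n => Eventually.of_forall fun s _ => hcK' _
      · exact intervalIntegrable_const
      · refine Eventually.of_forall fun s _ => (hc.tendsto _).comp ?_
        exact (((hU.tendsto _).comp (hτdelay s)).sub ((hU.tendsto _).comp (hτ (s - 1)))).add_const _
    refine hlim.congr' ?_
    obtain ⟨N, hN⟩ := exists_nat_ge z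
    filter_upwards [eventually_ge_atTop N] with n hn
    refine (hfe (φ n) z ?_).symm
    have h1 : (N : ℝ) ≤ φ n := by exact_mod_cast hn.trans (hφ.id_le n)
    have h2 : (((φ n + 1) * (φ n + 1) : ℕ) : ℝ) * (1 / ((φ n : ℝ) + 1)) = φ n + 1 := by
      push_cast; field_simp
    linarith
  refine ⟨τ, by rw [hint 0, integral_same], fun z => ?_⟩
  have := integral_hasDerivAt_right (hcont.intervalIntegrable 0 z)
    (hcont.stronglyMeasurableAtFilter _ _) hcont.continuousAt
  exact this.congr_of_eventuallyEq (Eventually.of_forall hint)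

/-- Continuity of translations in `L¹(ℝ)`. -/
theorem exists_integral_abs_translate_sub_lt {g : ℝ → ℝ} (hg : Integrable g) {ε : ℝ}
    (hε : 0 < ε) : ∃ δ > 0, ∀ h, |h| < δ → ∫ y, |g (y + h) - g y| < ε := by
  obtain ⟨k, hks, hk, hkc, hki⟩ :=
    hg.exists_hasCompactSupport_integral_sub_le (show 0 < ε / 3 by positivity)
  obtain ⟨A, hA⟩ := hks.isCompact.isBounded.subset_closedBall (0 : ℝ)
  have hA0 : ∀ y, A < |y| → k y = 0 := by
    intro y hy
    by_contra hne
    have := hA (subset_tsupport k hne)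
    rw [mem_closedBall_zero_iff, Real.norm_eq_abs] at this
    linarith
  set B := |A| + 1 with hB
  have hB0 : 0 < B := by positivity
  obtain ⟨δ, hδ, hδk⟩ := Metric.uniformContinuous_iff.1
    (hks.uniformContinuous_of_continuous hkc) (ε / (3 * (2 * B + 1))) (by positivity)
  refine ⟨min δ 1, by positivity, fun h hh => ?_⟩
  have hh1 := hh.trans_le (min_le_left _ _)
  have hh2 := hh.trans_le (min_le_right _ _)
  have hkh : Integrable fun y => k (y + h) := hki.comp_add_right h
  have hgh : Integrable fun y => g (y + h) := hg.comp_add_right h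
  have hi₁ : Integrable fun y => |g (y + h) - k (y + h)| := (hgh.sub hkh).abs
  have hi₂ : Integrable fun y => |k (y + h) - k y| := (hkh.sub hki).abs
  have hi₃ : Integrable fun y => |g y - k y| := (hg.sub hki).abs
  have hmid : ∫ y, |k (y + h) - k y| < ε / 3 := by
    have hsupp : ∀ y, y ∉ Icc (-B) B → |k (y + h) - k y| = 0 := by
      intro y hy
      have hy' : B < |y| := by
        rw [mem_Icc, ← abs_le, not_le] at hy; exact hy
      have h1 : A < |y| := by linarith [le_abs_self A]
      have h2 : A < |y + h| := by
        have := abs_sub_abs_le_abs_sub y (-h)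
        rw [sub_neg_eq_add, abs_neg] at this
        linarith [le_abs_self A]
      rw [hA0 _ h1, hA0 _ h2, sub_zero, abs_zero]
    rw [← setIntegral_eq_integral_of_forall_compl_eq_zero hsupp]
    have hb : ∀ y ∈ Icc (-B) B, |k (y + h) - k y| ≤ ε / (3 * (2 * B + 1)) := by
      intro y _
      have := hδk (a := y + h) (b := y) (by rw [Real.dist_eq, add_sub_cancel_left]; exact hh1)
      exact this.le
    calc ∫ y in Icc (-B) B, |k (y + h) - k y|
        ≤ ∫ y in Icc (-B) B, ε / (3 * (2 * B + 1)) :=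
          setIntegral_mono_on hi₂.integrableOn
            (integrableOn_const (by simp)) measurableSet_Icc hb
      _ = 2 * B * (ε / (3 * (2 * B + 1))) := by
          rw [setIntegral_const, Real.volume_real_Icc_of_le (by linarith), smul_eq_mul]; ring
      _ < ε / 3 := by
          rw [mul_div_assoc', div_lt_div_iff₀ (by positivity) (by positivity)]
          nlinarith
  have hout : ∫ y, |g (y + h) - k (y + h)| ≤ ε / 3 := by
    rw [integral_add_right_eq_self fun y => |g y - k y|]
    exact hk
  calc ∫ y, |g (y + h) - g y|
      ≤ ∫ y, (|g (y + h) - k (y + h)| + |k (y + h) - k y| + |g y - k y|) := by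
        refine integral_mono (hgh.sub hg).abs
          ((hi₁.add hi₂).add hi₃) fun y => ?_
        have := abs_add_three (g (y + h) - k (y + h)) (k (y + h) - k y) (k y - g y)
        rw [abs_sub_comm (k y)] at this
        refine le_trans (le_of_eq ?_) this
        congr 1; ring
    _ = (∫ y, |g (y + h) - k (y + h)|) + (∫ y, |k (y + h) - k y|) + ∫ y, |g y - k y| := by
        rw [← integral_add hi₁ hi₂]
        exact integral_add (hi₁.add hi₂) hi₃
    _ < ε := by
        have : ∫ y, |g y - k y| ≤ ε / 3 := hk
        linarith

section Characteristics

variable {e : ℝ ≃o ℝ} {v : ℝ → ℝ}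

theorem integrable_deriv_mul_comp_orderIso_iff (he : ∀ z, HasDerivAt e (v z) z) {H : ℝ → ℝ} :
    Integrable (fun z => v z * H (e z)) ↔ Integrable H := by
  have := integrableOn_image_iff_integrableOn_deriv_smul_of_monotoneOn MeasurableSet.univ
    (fun x _ => (he x).hasDerivWithinAt) (e.monotone.monotoneOn _) H
  rw [image_univ, e.surjective.range_eq, integrableOn_univ, integrableOn_univ] at this
  exact this.symm

theorem integral_deriv_mul_comp_orderIso (he : ∀ z, HasDerivAt e (v z) z) (H : ℝ → ℝ) :
    ∫ z, v z * H (e z) = ∫ t, H t := by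
  have := integral_image_eq_integral_deriv_smul_of_monotoneOn MeasurableSet.univ
    (fun x _ => (he x).hasDerivWithinAt) (e.monotone.monotoneOn _) H
  rw [image_univ, e.surjective.range_eq, setIntegral_univ, setIntegral_univ] at this
  exact this.symm

theorem hasDerivAt_orderIso_symm (he : ∀ z, HasDerivAt e (v z) z) (hv : ∀ z, 0 < v z) (t : ℝ) :
    HasDerivAt e.symm (v (e.symm t))⁻¹ t :=
  HasDerivAt.of_local_left_inverse e.symm.continuous.continuousAt (he _) (hv _).ne'
    (Eventually.of_forall e.apply_symm_apply)

end Characteristics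

section PartialDerivatives

variable {φ : ℝ → ℝ → ℝ}

theorem deriv_fst_eq_fderiv (hφ : ContDiff ℝ 1 (Function.uncurry φ)) (t x : ℝ) :
    deriv (fun s => φ s x) t = fderiv ℝ (Function.uncurry φ) (t, x) (1, 0) := by
  have h := ((hφ.differentiable one_ne_zero) (t, x)).hasFDerivAt.comp_hasDerivAt t
    ((hasDerivAt_id t).prodMk (hasDerivAt_const t x))
  exact h.deriv

theorem deriv_snd_eq_fderiv (hφ : ContDiff ℝ 1 (Function.uncurry φ)) (t x : ℝ) :
    deriv (φ t) x = fderiv ℝ (Function.uncurry φ) (t, x) (0, 1) := by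
  have h := ((hφ.differentiable one_ne_zero) (t, x)).hasFDerivAt.comp_hasDerivAt x
    ((hasDerivAt_const x t).prodMk (hasDerivAt_id x))
  exact h.deriv

/-- The derivative of `φ` along the vector field `(1, w)`. -/
def transportDeriv (φ : ℝ → ℝ → ℝ) (w : ℝ → ℝ) (p : ℝ × ℝ) : ℝ :=
  deriv (fun s => φ s p.2) p.1 + w p.1 * deriv (φ p.1) p.2

theorem continuous_transportDeriv (hφ : ContDiff ℝ 1 (Function.uncurry φ)) {w : ℝ → ℝ}
    (hw : Continuous w) : Continuous (transportDeriv φ w) := by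
  have hD := hφ.continuous_fderiv one_ne_zero
  unfold transportDeriv
  simp only [deriv_fst_eq_fderiv hφ, deriv_snd_eq_fderiv hφ]
  fun_prop

theorem hasDerivAt_comp_characteristic (hφ : ContDiff ℝ 1 (Function.uncurry φ)) {ξ w : ℝ → ℝ}
    {t : ℝ} (hξ : HasDerivAt ξ (w t) t) (z : ℝ) :
    HasDerivAt (fun t => φ t (ξ t - z)) (transportDeriv φ w (t, ξ t - z)) t := by
  have h := ((hφ.differentiable one_ne_zero) (t, ξ t - z)).hasFDerivAt.comp_hasDerivAt t
    ((hasDerivAt_id t).prodMk (hξ.sub_const z))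
  refine h.congr_deriv ?_
  unfold transportDeriv
  rw [deriv_fst_eq_fderiv hφ, deriv_snd_eq_fderiv hφ]
  rw [← smul_eq_mul, ← map_smul, ← map_add]
  simp

end PartialDerivatives

section Transport

variable {e : ℝ ≃o ℝ} {w : ℝ → ℝ} {φ : ℝ → ℝ → ℝ} {s : ℝ}

theorem setIntegral_transportDeriv_characteristic (hw : Continuous w)
    (he : ∀ t, HasDerivAt e.symm (w t) t) (hφ : ContDiff ℝ 1 (Function.uncurry φ))
    (hφs : ∀ x ∈ Icc (0 : ℝ) 1, φ s x = 0) (hφ1 : ∀ t ∈ Icc (0 : ℝ) s, φ t 1 = 0) (z : ℝ) :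
    ∫ t in Ioc (max 0 (e z)) (min s (e (z + 1))), transportDeriv φ w (t, e.symm t - z) =
      if max 0 (e z) ≤ min s (e (z + 1)) then
        -φ (max 0 (e z)) (e.symm (max 0 (e z)) - z) else 0 := by
  split_ifs with hab
  · have hcont : Continuous fun t => transportDeriv φ w (t, e.symm t - z) :=
      (continuous_transportDeriv hφ hw).comp
        (continuous_id.prodMk (e.symm.continuous.sub continuous_const))
    rw [← integral_of_le hab, integral_eq_sub_of_hasDerivAt
      (fun t _ => hasDerivAt_comp_characteristic hφ (he t) z) (hcont.intervalIntegrable _ _)]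
    obtain ⟨h0, h1⟩ := max_le_iff.1 hab
    have hend : φ (min s (e (z + 1))) (e.symm (min s (e (z + 1))) - z) = 0 := by
      rcases le_total s (e (z + 1)) with hs | hs
      · rw [min_eq_left hs] at h0 h1 ⊢
        have h2 := e.symm.monotone hs
        have h3 := e.symm.monotone h1
        rw [e.symm_apply_apply] at h2 h3
        exact hφs _ ⟨by linarith, by linarith⟩
      · rw [min_eq_right hs] at h0 ⊢
        rw [e.symm_apply_apply, add_sub_cancel_left]
        exact hφ1 _ ⟨h0, hs⟩
    simp only [hend, zero_sub]
  · rw [Ioc_eq_empty fun h => hab h.le, setIntegral_empty]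

theorem integral_transport {v q r : ℝ → ℝ} (he : ∀ z, HasDerivAt e (v z) z)
    (hv : Continuous v) (hv0 : ∀ z, 0 < v z) (he0 : e 0 = 0)
    (hq : Integrable q) (hr : Integrable r) (hq0 : ∀ t ≤ 0, q t = 0)
    (hr0 : ∀ x, x ∉ Ioc (0 : ℝ) 1 → r x = 0) (hs : 0 ≤ s)
    (hφ : ContDiff ℝ 1 (Function.uncurry φ))
    (hφs : ∀ x ∈ Icc (0 : ℝ) 1, φ s x = 0) (hφ1 : ∀ t ∈ Icc (0 : ℝ) s, φ t 1 = 0) :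
    (∫ t in Ioc 0 s, ∫ x in Ioc (0 : ℝ) 1,
      (v (e.symm t - x) * q (e (e.symm t - x)) + r (-(e.symm t - x))) *
        transportDeriv φ (fun t => (v (e.symm t))⁻¹) (t, x)) +
      (∫ t in Ioc 0 s, q t * φ t 0) + (∫ x in Ioc (0 : ℝ) 1, r x * φ 0 x) = 0 := by
  set w : ℝ → ℝ := fun t => (v (e.symm t))⁻¹ with hw_def
  have hξ := e.symm.continuous
  have hw : Continuous w := (hv.comp hξ).inv₀ fun t => (hv0 _).ne'
  have hφc : Continuous (Function.uncurry φ) := hφ.continuous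
  set D := transportDeriv φ w with hD_def
  have hD : Continuous D := continuous_transportDeriv hφ hw
  set g : ℝ → ℝ := fun z => v z * q (e z) + r (-z) with hg_def
  have hg : Integrable g := ((integrable_deriv_mul_comp_orderIso_iff he).2 hq).add hr.comp_neg
  set S : Set (ℝ × ℝ) := {p | p.1 ∈ Ioc 0 s ∧ e.symm p.1 - p.2 ∈ Ioc (0 : ℝ) 1} with hS_def
  have hS : MeasurableSet S := (measurable_fst measurableSet_Ioc).inter
    (((hξ.comp continuous_fst).sub continuous_snd).measurable measurableSet_Ioc)
  set A : ℝ × ℝ → ℝ := S.indicator fun p => D (p.1, e.symm p.1 - p.2) with hA_def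
  obtain ⟨C, hC⟩ := ((isCompact_Icc (a := (0 : ℝ)) (b := s)).prod
    (isCompact_Icc (a := (0 : ℝ)) (b := 1))).exists_bound_of_continuousOn hD.continuousOn
  have hC0 : 0 ≤ C := (norm_nonneg _).trans (hC (0, 0) ⟨⟨le_rfl, hs⟩, ⟨le_rfl, zero_le_one⟩⟩)
  have hAC : ∀ p, ‖A p‖ ≤ C := by
    intro p
    by_cases hp : p ∈ S
    · rw [hA_def, indicator_of_mem hp]
      exact hC _ ⟨Ioc_subset_Icc_self hp.1, Ioc_subset_Icc_self hp.2⟩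
    · rw [hA_def, indicator_of_notMem hp, norm_zero]; exact hC0
  have hAm : Measurable A := by
    refine Measurable.indicator (Continuous.measurable ?_) hS
    fun_prop
  have hint : Integrable (Function.uncurry fun t z => A (t, z) * g z)
      ((volume.restrict (Ioc 0 s)).prod volume) :=
    (hg.comp_snd _).bdd_mul hAm.aestronglyMeasurable (Eventually.of_forall hAC)
  have hinner : ∀ t ∈ Ioc 0 s, ∫ x in Ioc (0 : ℝ) 1, g (e.symm t - x) * D (t, x) =
      ∫ z, A (t, z) * g z := by
    intro t ht
    rw [← MeasureTheory.integral_indicator measurableSet_Ioc,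
      ← integral_sub_left_eq_self (fun z => A (t, z) * g z) volume (e.symm t)]
    refine integral_congr_ae (Eventually.of_forall fun x => ?_)
    by_cases hx : x ∈ Ioc (0 : ℝ) 1
    · have hmem : (t, e.symm t - x) ∈ S := ⟨ht, by simpa using hx⟩
      simp only [hA_def, indicator_of_mem hx, indicator_of_mem hmem, sub_sub_cancel]
      exact mul_comm _ _
    · have hmem : (t, e.symm t - x) ∉ S := fun h => hx (by simpa using h.2)
      simp only [hA_def, indicator_of_notMem hx, indicator_of_notMem hmem, zero_mul]
  set H : ℝ → ℝ := (Ioc 0 s).indicator fun t => q t * φ t 0 with hH_def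
  have houter : ∀ z, ∫ t in Ioc 0 s, A (t, z) * g z =
      -(v z * H (e z)) - r (-z) * φ 0 (-z) := by
    intro z
    rw [MeasureTheory.integral_mul_const]
    have hA1 : ∫ t in Ioc 0 s, A (t, z) =
        ∫ t in Ioc (max 0 (e z)) (min s (e (z + 1))), D (t, e.symm t - z) := by
      rw [← MeasureTheory.integral_indicator measurableSet_Ioc,
        ← MeasureTheory.integral_indicator measurableSet_Ioc]
      refine integral_congr_ae (Eventually.of_forall fun t => ?_)
      have hiff : (t, z) ∈ S ↔ t ∈ Ioc (max 0 (e z)) (min s (e (z + 1))) := by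
        simp only [hS_def, mem_ofPred_eq, mem_Ioc, max_lt_iff, le_min_iff, sub_pos,
          sub_le_iff_le_add, add_comm (1 : ℝ) z, ← e.symm_apply_le, ← e.lt_symm_apply]
        tauto
      by_cases ht : t ∈ Ioc (max 0 (e z)) (min s (e (z + 1)))
      · have h1 := hiff.2 ht
        have h2 : t ∈ Ioc 0 s := h1.1
        simp only [hA_def, indicator_of_mem ht, indicator_of_mem h1, indicator_of_mem h2]
      · have h1 : (t, z) ∉ S := fun h => ht (hiff.1 h)
        simp only [hA_def, indicator_of_notMem ht]
        exact indicator_apply_eq_zero.2 fun _ => indicator_of_notMem h1 _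
    rw [hA1, hD_def, setIntegral_transportDeriv_characteristic hw
      (hasDerivAt_orderIso_symm he hv0) hφ hφs hφ1]
    rcases lt_trichotomy z 0 with hz | rfl | hz
    · have hez : e z < 0 := by rw [← he0]; exact e.strictMono hz
      have hH0 : H (e z) = 0 := indicator_of_notMem (fun h => h.1.not_ge hez.le) _
      have hq0' : q (e z) = 0 := hq0 _ hez.le
      have hsymm0 : e.symm 0 = 0 := by rw [e.symm_apply_eq, he0]
      simp only [max_eq_left hez.le, hsymm0, hg_def, hq0', hH0, mul_zero, zero_add, zero_sub,
        neg_zero]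
      split_ifs with hcond
      · ring
      · have hz1 : z + 1 < 0 := by
          by_contra! h
          exact hcond (le_min hs (by rw [← he0]; exact e.monotone h))
        rw [hr0 (-z) fun h => by linarith [h.2]]
        ring
    · have hr0' : r 0 = 0 := hr0 0 fun h => lt_irrefl _ h.1
      have hH0 : H 0 = 0 := indicator_of_notMem (fun h => lt_irrefl _ h.1) _
      simp only [hg_def, he0, hq0 0 le_rfl, neg_zero, hr0', hH0]
      ring
    · have hez : 0 < e z := by rw [← he0]; exact e.strictMono hz
      have hr0' : r (-z) = 0 := hr0 _ fun h => by linarith [h.1]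
      simp only [max_eq_right hez.le, e.symm_apply_apply, sub_self, hg_def, hr0', le_min_iff,
        e.monotone (show z ≤ z + 1 by linarith), and_true, hH_def]
      by_cases hcond : e z ≤ s
      · rw [if_pos hcond, indicator_of_mem (show e z ∈ Ioc 0 s from ⟨hez, hcond⟩)]
        ring
      · rw [if_neg hcond, indicator_of_notMem fun h => hcond h.2]
        ring
  obtain ⟨B, hB⟩ := (isCompact_Icc (a := (0 : ℝ)) (b := s)).exists_bound_of_continuousOn
    (f := fun t => φ t 0) (by fun_prop)
  obtain ⟨B', hB'⟩ := (isCompact_Icc (a := (0 : ℝ)) (b := 1)).exists_bound_of_continuousOn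
    (f := fun x => φ 0 x) (by fun_prop)
  have hHi : Integrable H := by
    rw [hH_def, integrable_indicator_iff measurableSet_Ioc]
    refine hq.integrableOn.mul_bdd (c := B) (Continuous.aestronglyMeasurable (by fun_prop)) ?_
    exact (ae_restrict_mem measurableSet_Ioc).mono fun t ht => hB t (Ioc_subset_Icc_self ht)
  have hr_eq : (fun x => r x * φ 0 x) = (Ioc (0 : ℝ) 1).indicator fun x => r x * φ 0 x := by
    refine (indicator_eq_self.2 fun x hx => ?_).symm
    by_contra h
    exact hx (by simp only [hr0 x h, zero_mul])
  have hri : Integrable fun x => r x * φ 0 x := by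
    rw [hr_eq, integrable_indicator_iff measurableSet_Ioc]
    refine hr.integrableOn.mul_bdd (c := B') (Continuous.aestronglyMeasurable (by fun_prop)) ?_
    exact (ae_restrict_mem measurableSet_Ioc).mono fun t ht => hB' t (Ioc_subset_Icc_self ht)
  have hmain : (∫ t in Ioc 0 s, ∫ x in Ioc (0 : ℝ) 1, g (e.symm t - x) * D (t, x)) =
      -(∫ t in Ioc 0 s, q t * φ t 0) - ∫ x in Ioc (0 : ℝ) 1, r x * φ 0 x := by
    rw [setIntegral_congr_fun measurableSet_Ioc hinner, integral_integral_swap hint]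
    simp only [houter]
    have hvH : Integrable fun z => -(v z * H (e z)) :=
      ((integrable_deriv_mul_comp_orderIso_iff he).2 hHi).neg
    rw [MeasureTheory.integral_sub hvH hri.comp_neg, MeasureTheory.integral_neg, integral_deriv_mul_comp_orderIso he,
      integral_neg_eq_self (fun x => r x * φ 0 x), hH_def,
      MeasureTheory.integral_indicator measurableSet_Ioc,
      ← MeasureTheory.integral_indicator (f := fun x => r x * φ 0 x) measurableSet_Ioc, ← hr_eq]
  rw [hmain]
  ring

end Transport

section Mass

theorem integral_eq_zero_of_nonpos {f : ℝ → ℝ} (hf : ∀ t ≤ 0, f t = 0) {t : ℝ} (ht : t ≤ 0) :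
    ∫ s in (0 : ℝ)..t, f s = 0 := by
  rw [integral_congr (g := fun _ => (0 : ℝ)) fun x hx => ?_, intervalIntegral.integral_zero]
  rw [uIcc_of_ge ht] at hx
  exact hf x hx.2

theorem exists_orderIso_of_hasDerivAt {τ v : ℝ → ℝ} {m : ℝ} (hm : 0 < m) (hv : ∀ z, m ≤ v z)
    (hτ : ∀ z, HasDerivAt τ (v z) z) : ∃ e : ℝ ≃o ℝ, ⇑e = τ := by
  have hmono : StrictMono τ := strictMono_of_deriv_pos fun z => by
    rw [(hτ z).deriv]; exact hm.trans_le (hv z)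
  have hd : ∀ z, HasDerivAt (fun z => τ z - m * z) (v z - m * 1) z := fun z =>
    (hτ z).sub ((hasDerivAt_id z).const_mul m)
  have hlin : Monotone fun z => τ z - m * z :=
    monotone_of_deriv_nonneg (fun z => (hd z).differentiableAt) fun z => by
      rw [(hd z).deriv]; linarith [hv z]
  have htop : Tendsto τ atTop atTop := by
    refine tendsto_atTop_mono' _ ?_
      (tendsto_atTop_add_const_left _ (τ 0) (tendsto_id.const_mul_atTop hm))
    filter_upwards [eventually_ge_atTop 0] with z hz
    have := hlin hz
    simp only [mul_zero, sub_zero, id] at this ⊢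
    linarith
  have hbot : Tendsto τ atBot atBot := by
    refine tendsto_atBot_mono' _ ?_
      (tendsto_atBot_add_const_left _ (τ 0) (tendsto_id.const_mul_atBot hm))
    filter_upwards [eventually_le_atBot 0] with z hz
    have := hlin hz
    simp only [mul_zero, sub_zero, id] at this ⊢
    linarith
  have hcont : Continuous τ := continuous_iff_continuousAt.2 fun z => (hτ z).continuousAt
  exact ⟨hmono.orderIsoOfSurjective τ (hcont.surjective htop hbot), rfl⟩

theorem setIntegral_transported_density {e : ℝ ≃o ℝ} {v q r : ℝ → ℝ}
    (he : ∀ z, HasDerivAt e (v z) z) (hq : Integrable q) (hr : Integrable r)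
    (hr0 : ∀ x ≤ 0, r x = 0) {z : ℝ} (hz : 0 ≤ z) :
    ∫ x in Ioc (0 : ℝ) 1, (v (z - x) * q (e (z - x)) + r (-(z - x))) =
      (∫ s in (0 : ℝ)..e z, q s) - (∫ s in (0 : ℝ)..e (z - 1), q s) +
        ∫ x in (0 : ℝ)..(1 - z), r x := by
  have hvq := (integrable_deriv_mul_comp_orderIso_iff he).2 hq
  have hle : z - 1 ≤ z := by linarith
  have hflow : ∫ y in (z - 1)..z, v y * q (e y) = ∫ s in e (z - 1)..e z, q s := by
    rw [integral_of_le hle, integral_of_le (e.monotone hle),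
      ← MeasureTheory.integral_indicator measurableSet_Ioc,
      ← MeasureTheory.integral_indicator measurableSet_Ioc,
      ← integral_deriv_mul_comp_orderIso he ((Ioc (e (z - 1)) (e z)).indicator q)]
    refine integral_congr_ae (Eventually.of_forall fun y => ?_)
    have hiff : e y ∈ Ioc (e (z - 1)) (e z) ↔ y ∈ Ioc (z - 1) z := by simp [mem_Ioc]
    by_cases hy : y ∈ Ioc (z - 1) z
    · simp only [indicator_of_mem hy, indicator_of_mem (hiff.2 hy)]
    · simp only [indicator_of_notMem hy, indicator_of_notMem fun h => hy (hiff.1 h), mul_zero]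
  have hinit : ∫ y in (z - 1)..z, r (-y) = ∫ x in (0 : ℝ)..(1 - z), r x := by
    rw [integral_comp_neg, neg_sub,
      ← integral_interval_sub_left hr.intervalIntegrable hr.intervalIntegrable,
      integral_eq_zero_of_nonpos hr0 (neg_nonpos.2 hz), sub_zero]
  rw [← integral_of_le zero_le_one,
    integral_comp_sub_left (fun y => v y * q (e y) + r (-y)) z, sub_zero,
    intervalIntegral.integral_add hvq.intervalIntegrable hr.comp_neg.intervalIntegrable,
    hflow, hinit, integral_interval_sub_left hq.intervalIntegrable hq.intervalIntegrable]

end Mass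

/-- Existence of the characteristic flow, parametrised by the Lagrangian label: `e z` is the time
at which the characteristic with label `z` crosses `x = 0`. -/
theorem exists_characteristic_flow {lam q r : ℝ → ℝ} (hlam : Continuous lam)
    (hlam_pos : ∀ w, 0 < lam w) (hq : Integrable q) (hr : Integrable r)
    (hq_nn : ∀ t, 0 ≤ q t) (hr_nn : ∀ x, 0 ≤ r x)
    (hq0 : ∀ t ≤ 0, q t = 0) (hr0 : ∀ x ≤ 0, r x = 0) :
    ∃ (e : ℝ ≃o ℝ) (v : ℝ → ℝ) (K : ℝ), e 0 = 0 ∧ Continuous v ∧ (∀ z, 0 < v z) ∧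
      (∀ z, v z ≤ K) ∧ (∀ z, HasDerivAt e (v z) z) ∧
      ∀ z, 0 ≤ z → lam (∫ x in Ioc (0 : ℝ) 1, (v (z - x) * q (e (z - x)) + r (-(z - x)))) =
        (v z)⁻¹ := by
  set M := (∫ t, q t) + ∫ x, r x with hM
  have hM0 : 0 ≤ M := add_nonneg (MeasureTheory.integral_nonneg hq_nn)
    (MeasureTheory.integral_nonneg hr_nn)
  have hne : (Icc 0 M).Nonempty := ⟨0, le_rfl, hM0⟩
  obtain ⟨w₁, -, hw₁⟩ := isCompact_Icc.exists_isMinOn hne hlam.continuousOn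
  obtain ⟨w₂, -, hw₂⟩ := isCompact_Icc.exists_isMaxOn hne hlam.continuousOn
  set c : ℝ → ℝ := fun w => (lam (max 0 (min w M)))⁻¹ with hc_def
  have hclamp : ∀ w, max 0 (min w M) ∈ Icc 0 M := fun w =>
    ⟨le_max_left _ _, max_le hM0 (min_le_right _ _)⟩
  have hc : Continuous c :=
    (hlam.comp (by fun_prop)).inv₀ fun w => (hlam_pos _).ne'
  have hc0 : ∀ w, 0 < c w := fun w => inv_pos.2 (hlam_pos _)
  have hcK : ∀ w, c w ≤ (⟨(lam w₁)⁻¹, (inv_pos.2 (hlam_pos _)).le⟩ : NNReal) := fun w =>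
    inv_anti₀ (hlam_pos _) (hw₁ (hclamp w))
  have hcm : ∀ w, (lam w₂)⁻¹ ≤ c w := fun w => inv_anti₀ (hlam_pos _) (hw₂ (hclamp w))
  set U : ℝ → ℝ := fun t => ∫ s in (0 : ℝ)..t, q s with hU_def
  set R : ℝ → ℝ := fun x => ∫ s in (0 : ℝ)..x, r s with hR_def
  have hU : Continuous U := continuous_primitive (fun _ _ => hq.intervalIntegrable) 0
  have hR : Continuous R := continuous_primitive (fun _ _ => hr.intervalIntegrable) 0
  have hbounds : ∀ {f : ℝ → ℝ}, Integrable f → (∀ t, 0 ≤ f t) → (∀ t ≤ 0, f t = 0) → ∀ t,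
      0 ≤ (∫ s in (0 : ℝ)..t, f s) ∧ ∫ s in (0 : ℝ)..t, f s ≤ ∫ s, f s := by
    intro f hfi hf hf0 t
    rcases le_total t 0 with ht | ht
    · rw [integral_eq_zero_of_nonpos hf0 ht]
      exact ⟨le_rfl, MeasureTheory.integral_nonneg hf⟩
    · refine ⟨intervalIntegral.integral_nonneg ht fun s _ => hf s, ?_⟩
      rw [integral_of_le ht]
      exact setIntegral_le_integral hfi (Eventually.of_forall hf)
  obtain ⟨τ, hτ0, hτ⟩ := exists_delay_solution (P := fun z => R (1 - z)) hc hU (by fun_prop)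
    hc0 hcK (fun _ => integral_eq_zero_of_nonpos hq0)
  obtain ⟨e, rfl⟩ := exists_orderIso_of_hasDerivAt (inv_pos.2 (hlam_pos w₂)) (fun z => hcm _) hτ
  have he := e.continuous
  refine ⟨e, _, _, hτ0, ?_, fun z => hc0 _, fun z => hcK _, hτ, fun z hz => ?_⟩
  · fun_prop
  · rw [setIntegral_transported_density hτ hq hr hr0 hz]
    have hUmono : U (e (z - 1)) ≤ U (e z) := by
      rw [← sub_nonneg, hU_def]
      simp only
      rw [integral_interval_sub_left hq.intervalIntegrable hq.intervalIntegrable]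
      exact intervalIntegral.integral_nonneg (e.monotone (by linarith)) fun s _ => hq_nn s
    have h1 := hbounds hq hq_nn hq0 (e z)
    have h2 := hbounds hq hq_nn hq0 (e (z - 1))
    have h3 := hbounds hr hr_nn hr0 (1 - z)
    have hW0 : 0 ≤ U (e z) - U (e (z - 1)) + R (1 - z) := by linarith [h3.1]
    have hWM : U (e z) - U (e (z - 1)) + R (1 - z) ≤ M := by linarith [h1.2, h2.1, h3.2]
    simp only [hc_def, inv_inv, min_eq_left hWM, max_eq_right hW0]
    rfl

/-- Hidden regularity: the unique weak solution (for a suitable representative)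
also belongs to `C⁰([0,1]; L¹(0,T))`; in particular, for every fixed `x ∈ [0,1]`
the trace `t ↦ ρ(t,x)` is a well-defined element of `L¹(0,T)`. -/
theorem hidden_regularity
    (lam : ℝ → ℝ) (hlam : ContDiff ℝ 1 lam) (hlam_pos : ∀ w, 0 < lam w)
    (T : ℝ) (hT : 0 < T) (ρ₀ u : ℝ → ℝ)
    (hρ₀ : MeasureTheory.IntegrableOn ρ₀ (Set.Ioc 0 1))
    (hu : MeasureTheory.IntegrableOn u (Set.Ioc 0 T))
    (hρ₀nn : ∀ᵐ x ∂(volume.restrict (Set.Ioc (0:ℝ) 1)), 0 ≤ ρ₀ x)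
    (hunn : ∀ᵐ t ∂(volume.restrict (Set.Ioc (0:ℝ) T)), 0 ≤ u t) :
    ∃ ρ : ℝ → ℝ → ℝ, IsWeakSolution lam T ρ₀ u ρ ∧
      (∀ x ∈ Set.Icc (0:ℝ) 1,
          MeasureTheory.IntegrableOn (fun t => ρ t x) (Set.Ioc 0 T)) ∧
      (∀ x ∈ Set.Icc (0:ℝ) 1, ∀ ε > (0:ℝ), ∃ η > (0:ℝ), ∀ x' ∈ Set.Icc (0:ℝ) 1,
          |x' - x| < η → (∫ t in Set.Ioc (0:ℝ) T, |ρ t x' - ρ t x|) < ε) := by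
  set q : ℝ → ℝ := (Ioc 0 T).indicator fun t => |u t| with hq_def
  set r : ℝ → ℝ := (Ioc (0 : ℝ) 1).indicator fun x => |ρ₀ x| with hr_def
  have hq : Integrable q := IntegrableOn.integrable_indicator hu.abs measurableSet_Ioc
  have hr : Integrable r := IntegrableOn.integrable_indicator hρ₀.abs measurableSet_Ioc
  have hq_nn : ∀ t, 0 ≤ q t := fun t => indicator_nonneg (fun _ _ => abs_nonneg _) t
  have hr_nn : ∀ x, 0 ≤ r x := fun x => indicator_nonneg (fun _ _ => abs_nonneg _) x
  have hq0 : ∀ t ≤ 0, q t = 0 := fun t ht => indicator_of_notMem (fun h => h.1.not_ge ht) _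
  have hr0 : ∀ x, x ∉ Ioc (0 : ℝ) 1 → r x = 0 := fun x hx => indicator_of_notMem hx _
  obtain ⟨e, v, K, he0, hv, hv0, hvK, he, hspeed⟩ := exists_characteristic_flow hlam.continuous
    hlam_pos hq hr hq_nn hr_nn hq0 fun x hx => hr0 x fun h => h.1.not_ge hx
  have hK : 0 < K := (hv0 0).trans_le (hvK 0)
  set g : ℝ → ℝ := fun z => v z * q (e z) + r (-z) with hg_def
  have hg : Integrable g := ((integrable_deriv_mul_comp_orderIso_iff he).2 hq).add hr.comp_neg
  have hξ_nn : ∀ t, 0 ≤ t → 0 ≤ e.symm t := fun t ht => by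
    rw [e.le_symm_apply, he0]; exact ht
  have hgx : ∀ x, Integrable fun t => g (e.symm t - x) := by
    intro x
    rw [← integrable_deriv_mul_comp_orderIso_iff he]
    simp only [e.symm_apply_apply]
    refine (hg.comp_sub_right x).bdd_mul (c := K) hv.aestronglyMeasurable
      (Eventually.of_forall fun z => ?_)
    rw [Real.norm_of_nonneg (hv0 z).le]
    exact hvK z
  refine ⟨fun t x => g (e.symm t - x), ⟨fun t _ => (hg.comp_sub_left _).integrableOn, ?_, ?_⟩,
    fun x _ => (hgx x).integrableOn, ?_⟩
  · intro t _ ε hε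
    obtain ⟨δ, hδ, hδg⟩ := exists_integral_abs_translate_sub_lt hg hε
    obtain ⟨η, hη, hηξ⟩ := Metric.continuousAt_iff.1 (e.symm.continuous.continuousAt (x := t)) δ hδ
    refine ⟨η, hη, fun s _ hst => lt_of_le_of_lt ?_ (hδg (e.symm s - e.symm t) (hηξ hst))⟩
    rw [← integral_sub_left_eq_self (fun y => |g (y + (e.symm s - e.symm t)) - g y|) volume
      (e.symm t)]
    have heq : ∀ x, e.symm t - x + (e.symm s - e.symm t) = e.symm s - x := fun x => by ring
    simp only [heq]
    exact setIntegral_le_integral ((hg.comp_sub_left _).sub (hg.comp_sub_left _)).abs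
      (Eventually.of_forall fun x => abs_nonneg _)
  · intro s hs φ hφ hφs hφ1
    refine Eq.trans ?_ (integral_transport he hv hv0 he0 hq hr hq0 hr0 hs.1 hφ hφs hφ1)
    congr 1
    · congr 1
      · refine setIntegral_congr_fun measurableSet_Ioc fun t ht => ?_
        simp only [transportDeriv, hg_def]
        rw [hspeed _ (hξ_nn t ht.1.le)]
      · refine setIntegral_congr_ae measurableSet_Ioc ?_
        filter_upwards [(ae_restrict_iff' measurableSet_Ioc).1 hunn] with t ht hts
        have htT : t ∈ Ioc 0 T := ⟨hts.1, hts.2.trans hs.2⟩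
        rw [hq_def, indicator_of_mem htT, abs_of_nonneg (ht htT)]
    · refine setIntegral_congr_ae measurableSet_Ioc ?_
      filter_upwards [(ae_restrict_iff' measurableSet_Ioc).1 hρ₀nn] with x hx hxs
      rw [hr_def, indicator_of_mem hxs, abs_of_nonneg (hx hxs)]
  · intro x _ ε hε
    obtain ⟨δ, hδ, hδg⟩ := exists_integral_abs_translate_sub_lt hg (div_pos hε hK)
    refine ⟨δ, hδ, fun x' _ hx' => ?_⟩
    have hlt := hδg (x - x') (by rwa [abs_sub_comm])
    rw [lt_div_iff₀ hK] at hlt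
    refine lt_of_le_of_lt ?_ hlt
    have hdiff : Integrable fun z => |g (z - x') - g (z - x)| :=
      ((hg.comp_sub_right _).sub (hg.comp_sub_right _)).abs
    calc ∫ t in Ioc 0 T, |g (e.symm t - x') - g (e.symm t - x)|
        ≤ ∫ t, |g (e.symm t - x') - g (e.symm t - x)| :=
          setIntegral_le_integral ((hgx x').sub (hgx x)).abs
            (Eventually.of_forall fun t => abs_nonneg _)
      _ = ∫ z, v z * |g (z - x') - g (z - x)| := by
          rw [← integral_deriv_mul_comp_orderIso he]
          simp only [e.symm_apply_apply]
      _ ≤ ∫ z, K * |g (z - x') - g (z - x)| := by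
          refine integral_mono_of_nonneg
            (Eventually.of_forall fun z => mul_nonneg (hv0 z).le (abs_nonneg _))
            (hdiff.const_mul K)
            (Eventually.of_forall fun z => mul_le_mul_of_nonneg_right (hvK z) (abs_nonneg _))
      _ = (∫ y, |g (y + (x - x')) - g y|) * K := by
          rw [MeasureTheory.integral_const_mul, mul_comm,
            ← integral_sub_right_eq_self (fun y => |g (y + (x - x')) - g y|) x]
          simp only [sub_add_sub_cancel]
end
end

section
/- Suppose λ(W)=1/(1+W) and let 0≤ρ0<ρ1 be constants. Consider weak solutions of ∂_tρ+∂_x(λ(W(t))ρ)=0, W(t)=∫₀¹ρ(t,x)dx, with initial equilibrium state ρ(0,x)=ρ0 for x∈(0,1], and boundary influx u(t)=λ(W(t))ρ(t,0) with u∈L¹([0,∞);[0,∞)). Then the minimum time T>0 for which there exists such an admissible control steering the system to the equilibrium ρ(T,x)=ρ1 for all x∈[0,1] equals T = 1 + (ρ0+ρ1)/2; in particular, (i) for any admissible control achieving ρ(T,·)≡ρ1 one has T ≥ 1+(ρ0+ρ1)/2, and (ii) the constant boundary data ρ(t,0)=ρ1 for all t≥0 achieves the transfer exactly at time T = 1+(ρ0+ρ1)/2.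 -/
open MeasureTheory Set intervalIntegral

noncomputable section

open Filter Topology

section PartialDerivatives

variable {φ : ℝ → ℝ → ℝ}

lemma hasDerivAt_fst_fderiv (hφ : ContDiff ℝ 1 (Function.uncurry φ)) (t x : ℝ) :
    HasDerivAt (fun s => φ s x) (fderiv ℝ (Function.uncurry φ) (t, x) (1, 0)) t := by
  have h1 : HasFDerivAt (Function.uncurry φ) (fderiv ℝ (Function.uncurry φ) (t, x)) (t, x) :=
    (hφ.differentiable one_ne_zero (t, x)).hasFDerivAt
  exact h1.comp_hasDerivAt (f := fun s => (s, x)) t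
    ((hasDerivAt_id t).prodMk (hasDerivAt_const t x))

lemma hasDerivAt_snd_fderiv (hφ : ContDiff ℝ 1 (Function.uncurry φ)) (t x : ℝ) :
    HasDerivAt (φ t) (fderiv ℝ (Function.uncurry φ) (t, x) (0, 1)) x := by
  have h1 : HasFDerivAt (Function.uncurry φ) (fderiv ℝ (Function.uncurry φ) (t, x)) (t, x) :=
    (hφ.differentiable one_ne_zero (t, x)).hasFDerivAt
  exact h1.comp_hasDerivAt (f := fun y => (t, y)) x
    ((hasDerivAt_const x t).prodMk (hasDerivAt_id x))

lemma hasDerivAt_fst (hφ : ContDiff ℝ 1 (Function.uncurry φ)) (t x : ℝ) :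
    HasDerivAt (fun s => φ s x) (deriv (fun s => φ s x) t) t :=
  (hasDerivAt_fst_fderiv hφ t x).differentiableAt.hasDerivAt

lemma hasDerivAt_snd (hφ : ContDiff ℝ 1 (Function.uncurry φ)) (t x : ℝ) :
    HasDerivAt (φ t) (deriv (φ t) x) x :=
  (hasDerivAt_snd_fderiv hφ t x).differentiableAt.hasDerivAt

lemma continuous_deriv_fst (hφ : ContDiff ℝ 1 (Function.uncurry φ)) :
    Continuous (Function.uncurry fun t x => deriv (fun s => φ s x) t) := by
  have : (Function.uncurry fun t x => deriv (fun s => φ s x) t)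
      = fun p : ℝ × ℝ => fderiv ℝ (Function.uncurry φ) p (1, 0) := by
    ext ⟨t, x⟩
    exact (hasDerivAt_fst_fderiv hφ t x).deriv
  rw [this]
  exact (hφ.continuous_fderiv one_ne_zero).clm_apply continuous_const

lemma continuous_deriv_snd (hφ : ContDiff ℝ 1 (Function.uncurry φ)) :
    Continuous (Function.uncurry fun t x => deriv (φ t) x) := by
  have : (Function.uncurry fun t x => deriv (φ t) x)
      = fun p : ℝ × ℝ => fderiv ℝ (Function.uncurry φ) p (0, 1) := by
    ext ⟨t, x⟩
    exact (hasDerivAt_snd_fderiv hφ t x).deriv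
  rw [this]
  exact (hφ.continuous_fderiv one_ne_zero).clm_apply continuous_const

end PartialDerivatives

lemma integrableOn_mul_of_continuous {f g : ℝ → ℝ} {a b : ℝ} (hf : IntegrableOn f (Ioc a b))
    (hg : Continuous g) : IntegrableOn (fun x => f x * g x) (Ioc a b) := by
  rw [← integrableOn_Icc_iff_integrableOn_Ioc] at hf ⊢
  exact hf.mul_continuousOn hg.continuousOn isCompact_Icc

lemma integrableOn_mul_of_continuousOn {f g : ℝ → ℝ} {a b : ℝ} (hf : IntegrableOn f (Ioc a b))
    (hg : ContinuousOn g (Icc a b)) : IntegrableOn (fun x => f x * g x) (Ioc a b) := by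
  rw [← integrableOn_Icc_iff_integrableOn_Ioc] at hf ⊢
  exact hf.mul_continuousOn hg isCompact_Icc

lemma tendsto_integral_mul_of_bounded {s : Set ℝ} (hs : MeasurableSet s) {f : ℝ → ℝ}
    (hf : IntegrableOn f s)
    {g : ℕ → ℝ → ℝ} {g₀ : ℝ → ℝ} (C : ℝ) (hg : ∀ n, Continuous (g n))
    (hC : ∀ n, ∀ x ∈ s, |g n x| ≤ C)
    (hlim : ∀ᵐ x ∂(volume.restrict s), Tendsto (fun n => g n x) atTop (𝓝 (g₀ x))) :
    Tendsto (fun n => ∫ x in s, f x * g n x) atTop (𝓝 (∫ x in s, f x * g₀ x)) := by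
  refine tendsto_integral_of_dominated_convergence (fun x => |f x| * C) ?_ ?_ ?_ ?_
  · exact fun n => hf.aestronglyMeasurable.mul (hg n).aestronglyMeasurable
  · exact hf.abs.mul_const C
  · intro n
    filter_upwards [ae_restrict_mem hs] with x hx
    rw [Real.norm_eq_abs, abs_mul]
    exact mul_le_mul_of_nonneg_left (hC n x hx) (abs_nonneg _)
  · filter_upwards [hlim] with x hx
    exact hx.const_mul _

lemma continuousOn_integral_mul {T : ℝ} {ρ : ℝ → ℝ → ℝ} {h : ℝ → ℝ → ℝ}
    (hint : ∀ t ∈ Icc (0:ℝ) T, IntegrableOn (ρ t) (Ioc 0 1))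
    (hcont : ∀ t ∈ Icc (0:ℝ) T, ∀ ε > (0:ℝ), ∃ η > (0:ℝ), ∀ s ∈ Icc (0:ℝ) T,
      |s - t| < η → (∫ x in Ioc (0:ℝ) 1, |ρ s x - ρ t x|) < ε)
    (hh : Continuous (Function.uncurry h)) :
    ContinuousOn (fun t => ∫ x in Ioc (0:ℝ) 1, ρ t x * h t x) (Icc 0 T) := by
  have hsec : ∀ t, Continuous (h t) := fun t => hh.comp (Continuous.prodMk_right t)
  obtain ⟨C, hC⟩ := ((isCompact_Icc (a := (0:ℝ)) (b := T)).prod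
    (isCompact_Icc (a := (0:ℝ)) (b := 1))).exists_bound_of_continuousOn hh.continuousOn
  have hC' : ∀ t ∈ Icc (0:ℝ) T, ∀ x ∈ Ioc (0:ℝ) 1, |h t x| ≤ C :=
    fun t ht x hx => hC (t, x) ⟨ht, hx.1.le, hx.2⟩
  intro t ht
  have hd : Tendsto (fun s => ∫ x in Ioc (0:ℝ) 1, |ρ s x - ρ t x|) (𝓝[Icc 0 T] t) (𝓝 0) := by
    rw [Metric.tendsto_nhdsWithin_nhds]
    intro ε hε
    obtain ⟨η, hη, H⟩ := hcont t ht ε hε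
    refine ⟨η, hη, fun s hs hst => ?_⟩
    rw [Real.dist_eq] at hst
    rw [Real.dist_eq, sub_zero, abs_of_nonneg (integral_nonneg fun _ => abs_nonneg _)]
    exact H s hs hst
  have h1 : Tendsto (fun s => ∫ x in Ioc (0:ℝ) 1, (ρ s x - ρ t x) * h s x)
      (𝓝[Icc 0 T] t) (𝓝 0) := by
    refine squeeze_zero_norm' ?_ (by simpa using hd.mul_const C)
    filter_upwards [self_mem_nhdsWithin] with s hs
    have hi := (hint s hs).sub (hint t ht)
    calc ‖∫ x in Ioc (0:ℝ) 1, (ρ s x - ρ t x) * h s x‖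
        ≤ ∫ x in Ioc (0:ℝ) 1, |ρ s x - ρ t x| * C := by
          refine norm_integral_le_of_norm_le (hi.abs.mul_const C) ?_
          filter_upwards [ae_restrict_mem measurableSet_Ioc] with x hx
          rw [Real.norm_eq_abs, abs_mul]
          exact mul_le_mul_of_nonneg_left (hC' s hs x hx) (abs_nonneg _)
      _ = _ := MeasureTheory.integral_mul_const _ _
  have h2 : Tendsto (fun s => ∫ x in Ioc (0:ℝ) 1, ρ t x * h s x)
      (𝓝[Icc 0 T] t) (𝓝 (∫ x in Ioc (0:ℝ) 1, ρ t x * h t x)) := by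
    refine tendsto_integral_filter_of_dominated_convergence (fun x => |ρ t x| * C) ?_ ?_ ?_ ?_
    · exact Eventually.of_forall fun s =>
        (hint t ht).aestronglyMeasurable.mul (hsec s).aestronglyMeasurable
    · filter_upwards [self_mem_nhdsWithin] with s hs
      filter_upwards [ae_restrict_mem measurableSet_Ioc] with x hx
      rw [Real.norm_eq_abs, abs_mul]
      exact mul_le_mul_of_nonneg_left (hC' s hs x hx) (abs_nonneg _)
    · exact (hint t ht).abs.mul_const C
    · refine Eventually.of_forall fun x => ?_
      have : Continuous fun s => h s x := hh.comp (Continuous.prodMk_left x)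
      exact ((this.tendsto t).mono_left nhdsWithin_le_nhds).const_mul _
  have h3 := h1.add h2
  rw [zero_add] at h3
  refine h3.congr' ?_
  filter_upwards [self_mem_nhdsWithin] with s hs
  rw [← MeasureTheory.integral_add]
  · congr 1; ext x; ring
  · exact integrableOn_mul_of_continuous ((hint s hs).sub (hint t ht)) (hsec s)
  · exact integrableOn_mul_of_continuous (hint t ht) (hsec s)

/-- The kernels `(n + 1) / τ * (t / τ) ^ n` on `[0, τ]` concentrate at `τ`. -/
lemma tendsto_integral_pow_kernel {τ : ℝ} (hτ : 0 < τ) {g : ℝ → ℝ}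
    (hg : ContinuousOn g (Icc 0 τ)) :
    Tendsto (fun n : ℕ => ∫ t in Ioc 0 τ, ((n + 1 : ℝ) / τ * (t / τ) ^ n) * g t) atTop
      (𝓝 (g τ)) := by
  have key := tendsto_setIntegral_pow_smul_of_unique_maximum_of_isCompact_of_continuousOn
    (μ := (volume : Measure ℝ)) (s := Icc 0 τ) (x₀ := τ) (c := fun t => t / τ) (g := g)
    isCompact_Icc (by fun_prop) ?_ ?_ ?_ ?_ hg
  · refine key.congr fun n => ?_
    have hI : ∫ t in Icc 0 τ, (t / τ) ^ n = τ / (n + 1) := by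
      rw [integral_Icc_eq_integral_Ioc, ← intervalIntegral.integral_of_le hτ.le,
        intervalIntegral.integral_comp_div (fun t => t ^ n) hτ.ne', integral_pow]
      simp [hτ.ne', div_eq_mul_inv]
    rw [hI, inv_div, integral_Icc_eq_integral_Ioc, smul_eq_mul, ← MeasureTheory.integral_const_mul]
    congr 1; ext t; simp only [smul_eq_mul]; ring
  · intro y hy hne
    have : y < τ := lt_of_le_of_ne hy.2 hne
    simpa using div_lt_div_of_pos_right this hτ
  · exact fun x hx => div_nonneg hx.1 hτ.le
  · simp [hτ.ne']
  · rw [interior_Icc, closure_Ioo hτ.ne]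
    exact right_mem_Icc.2 hτ.le

namespace IsWeakSolution

variable {lam : ℝ → ℝ} {T : ℝ} {ρ₀ u : ℝ → ℝ} {ρ : ℝ → ℝ → ℝ}

lemma continuousOn_integral_mul (hw : IsWeakSolution lam T ρ₀ u ρ) {h : ℝ → ℝ → ℝ}
    (hh : Continuous (Function.uncurry h)) :
    ContinuousOn (fun t => ∫ x in Ioc (0:ℝ) 1, ρ t x * h t x) (Icc 0 T) :=
  _root_.continuousOn_integral_mul hw.1 hw.2.1 hh

lemma continuousOn_mass (hw : IsWeakSolution lam T ρ₀ u ρ) :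
    ContinuousOn (fun t => ∫ x in Ioc (0:ℝ) 1, ρ t x) (Icc 0 T) := by
  simpa using hw.continuousOn_integral_mul (h := fun _ _ => 1) continuous_const

/-- The weak formulation for test functions that need not vanish at the final time. -/
lemma integral_eq_terminal (hw : IsWeakSolution lam T ρ₀ u ρ) (hu : IntegrableOn u (Ioc 0 T))
    {τ : ℝ} (hτ : τ ∈ Ioc 0 T) {φ : ℝ → ℝ → ℝ} (hφ : ContDiff ℝ 1 (Function.uncurry φ))
    (hφ1 : ∀ t ∈ Icc (0:ℝ) τ, φ t 1 = 0)
    (hF : IntegrableOn (fun t => ∫ x in Ioc (0:ℝ) 1, ρ t x * (deriv (fun s => φ s x) t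
      + lam (∫ y in Ioc (0:ℝ) 1, ρ t y) * deriv (φ t) x)) (Ioc 0 τ)) :
    (∫ t in Ioc (0:ℝ) τ, ∫ x in Ioc (0:ℝ) 1, ρ t x * (deriv (fun s => φ s x) t
        + lam (∫ y in Ioc (0:ℝ) 1, ρ t y) * deriv (φ t) x))
      + (∫ t in Ioc (0:ℝ) τ, u t * φ t 0) + (∫ x in Ioc (0:ℝ) 1, ρ₀ x * φ 0 x)
      = ∫ x in Ioc (0:ℝ) 1, ρ τ x * φ τ x := by
  obtain ⟨hτ0, hτT⟩ := hτ
  set F : ℝ → ℝ := fun t => ∫ x in Ioc (0:ℝ) 1, ρ t x * (deriv (fun s => φ s x) t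
      + lam (∫ y in Ioc (0:ℝ) 1, ρ t y) * deriv (φ t) x) with hFdef
  set G : ℝ → ℝ := fun t => ∫ x in Ioc (0:ℝ) 1, ρ t x * φ t x with hGdef
  have hG : ContinuousOn G (Icc 0 τ) :=
    (hw.continuousOn_integral_mul hφ.continuous).mono (Icc_subset_Icc_right hτT)
  have hsub : Ioc 0 τ ⊆ Ioc 0 T := Ioc_subset_Ioc_right hτT
  have hu0 : IntegrableOn (fun t => u t * φ t 0) (Ioc 0 τ) :=
    integrableOn_mul_of_continuous (hu.mono_set hsub)
      (hφ.continuous.comp (Continuous.prodMk_left 0))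
  have hχ : ∀ n : ℕ, ∀ t, HasDerivAt (fun t : ℝ => 1 - (t / τ) ^ (n + 1))
      (-((n + 1 : ℝ) / τ * (t / τ) ^ n)) t := by
    intro n t
    have := (((hasDerivAt_id' t).div_const τ).fun_pow (n + 1)).const_sub 1
    exact this.congr_deriv (by rw [Nat.add_sub_cancel]; push_cast; ring)
  have hχC : ∀ n : ℕ, ContDiff ℝ 1 (fun t : ℝ => 1 - (t / τ) ^ (n + 1)) := by
    intro n; fun_prop
  have hχb : ∀ n : ℕ, ∀ t ∈ Ioc 0 τ, |1 - (t / τ) ^ (n + 1)| ≤ 1 := by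
    intro n t ht
    have h1 : 0 ≤ t / τ := div_nonneg ht.1.le hτ0.le
    have h2 : t / τ ≤ 1 := (div_le_one hτ0).2 ht.2
    have h3 := pow_le_one₀ (n := n + 1) h1 h2
    have h4 := pow_nonneg h1 (n + 1)
    rw [abs_le]; constructor <;> linarith
  have hχl : ∀ᵐ t ∂(volume.restrict (Ioc 0 τ)),
      Tendsto (fun n : ℕ => 1 - (t / τ) ^ (n + 1)) atTop (𝓝 1) := by
    have hne : ∀ᵐ t ∂(volume.restrict (Ioc 0 τ)), t ≠ τ :=
      ae_restrict_of_ae (by simp [ae_iff])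
    filter_upwards [ae_restrict_mem measurableSet_Ioc, hne] with t ht hne
    have h1 : 0 ≤ t / τ := div_nonneg ht.1.le hτ0.le
    have h2 : t / τ < 1 := (div_lt_one hτ0).2 (lt_of_le_of_ne ht.2 hne)
    have := ((tendsto_pow_atTop_nhds_zero_of_lt_one h1 h2).comp
      (tendsto_add_atTop_nat 1)).const_sub 1
    simpa using this
  have hid : ∀ n : ℕ,
      -(∫ t in Ioc 0 τ, ((n + 1 : ℝ) / τ * (t / τ) ^ n) * G t)
        + (∫ t in Ioc 0 τ, F t * (1 - (t / τ) ^ (n + 1)))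
        + (∫ t in Ioc 0 τ, u t * φ t 0 * (1 - (t / τ) ^ (n + 1)))
        + (∫ x in Ioc (0:ℝ) 1, ρ₀ x * φ 0 x) = 0 := by
    intro n
    have key := hw.2.2 τ ⟨hτ0.le, hτT⟩ (fun t x => (1 - (t / τ) ^ (n + 1)) * φ t x) ?_ ?_ ?_
    · have e1 : ∀ t ∈ Ioc 0 τ, (∫ x in Ioc (0:ℝ) 1,
          ρ t x * (deriv (fun s => (1 - (s / τ) ^ (n + 1)) * φ s x) t
            + lam (∫ y in Ioc (0:ℝ) 1, ρ t y)
              * deriv (fun x => (1 - (t / τ) ^ (n + 1)) * φ t x) x))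
          = -(((n + 1 : ℝ) / τ * (t / τ) ^ n) * G t) + F t * (1 - (t / τ) ^ (n + 1)) := by
        intro t ht
        have htT : t ∈ Icc 0 T := ⟨ht.1.le, ht.2.trans hτT⟩
        have hi1 : IntegrableOn (fun x => ρ t x * φ t x) (Ioc 0 1) :=
          integrableOn_mul_of_continuous (hw.1 t htT)
            (hφ.continuous.comp (Continuous.prodMk_right t))
        have hi2 : IntegrableOn (fun x => ρ t x * (deriv (fun s => φ s x) t
            + lam (∫ y in Ioc (0:ℝ) 1, ρ t y) * deriv (φ t) x)) (Ioc 0 1) := by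
          refine integrableOn_mul_of_continuous (hw.1 t htT) (Continuous.add ?_
            (continuous_const.mul ?_))
          · exact (continuous_deriv_fst hφ).comp (Continuous.prodMk_right t)
          · exact (continuous_deriv_snd hφ).comp (Continuous.prodMk_right t)
        rw [hGdef, hFdef, ← MeasureTheory.integral_mul_const,
          ← MeasureTheory.integral_const_mul, ← MeasureTheory.integral_neg,
          ← MeasureTheory.integral_add (f := fun x => -((n + 1 : ℝ) / τ * (t / τ) ^ n
            * (ρ t x * φ t x))) (hi1.const_mul _).neg (hi2.mul_const _)]
        congr 1
        ext x
        rw [((hχ n t).fun_mul (hasDerivAt_fst hφ t x)).deriv,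
          ((hasDerivAt_snd hφ t x).const_mul _).deriv]
        ring
      rw [setIntegral_congr_fun measurableSet_Ioc e1] at key
      rw [MeasureTheory.integral_add, MeasureTheory.integral_neg] at key
      · convert key using 3
        · congr 1; ext t; ring
        · simp
      · refine Integrable.neg ?_
        have hc : ContinuousOn (fun t => ((n + 1 : ℝ) / τ * (t / τ) ^ n) * G t) (Icc 0 τ) :=
          ContinuousOn.mul (by fun_prop) hG
        exact hc.integrableOn_Icc.mono_set Ioc_subset_Icc_self
      · exact integrableOn_mul_of_continuous hF (hχC n).continuous
    · exact ((hχC n).comp contDiff_fst).mul hφ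
    · intro x _
      simp [hτ0.ne']
    · intro t ht
      simp [hφ1 t ht]
  have l1 := tendsto_integral_pow_kernel hτ0 hG
  have l2 := tendsto_integral_mul_of_bounded measurableSet_Ioc hF 1
    (fun n => (hχC n).continuous) hχb hχl
  have l3 := tendsto_integral_mul_of_bounded measurableSet_Ioc hu0 1
    (fun n => (hχC n).continuous) hχb hχl
  have l4 := ((l1.neg.add l2).add l3).add_const (∫ x in Ioc (0:ℝ) 1, ρ₀ x * φ 0 x)
  have := tendsto_nhds_unique (l4.congr hid) tendsto_const_nhds
  simp only [mul_one] at this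
  linarith

/-- The weak formulation along a characteristic: for a test function of `x - ξ t`, only the data
and the final state contribute. -/
lemma integral_comp_sub_characteristic (hw : IsWeakSolution lam T ρ₀ u ρ)
    (hu : IntegrableOn u (Ioc 0 T)) {τ : ℝ} (hτ : τ ∈ Ioc 0 T) {ξ ψ : ℝ → ℝ}
    (hξ : ContDiff ℝ 1 ξ) (hψ : ContDiff ℝ 1 ψ)
    (hξ' : ∀ t ∈ Ioc 0 τ, deriv ξ t = lam (∫ y in Ioc (0:ℝ) 1, ρ t y)
      ∨ ∀ x ∈ Ioc (0:ℝ) 1, deriv ψ (x - ξ t) = 0)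
    (hψ1 : ∀ t ∈ Icc 0 τ, ψ (1 - ξ t) = 0) :
    (∫ t in Ioc (0:ℝ) τ, u t * ψ (0 - ξ t)) + (∫ x in Ioc (0:ℝ) 1, ρ₀ x * ψ (x - ξ 0))
      = ∫ x in Ioc (0:ℝ) 1, ρ τ x * ψ (x - ξ τ) := by
  have hφ : ContDiff ℝ 1 (Function.uncurry fun t x => ψ (x - ξ t)) :=
    hψ.comp (contDiff_snd.sub (hξ.comp contDiff_fst))
  have hF : ∀ t ∈ Ioc 0 τ, (∫ x in Ioc (0:ℝ) 1, ρ t x * (deriv (fun s => ψ (x - ξ s)) t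
      + lam (∫ y in Ioc (0:ℝ) 1, ρ t y) * deriv (fun x => ψ (x - ξ t)) x)) = 0 := by
    intro t ht
    refine setIntegral_eq_zero_of_forall_eq_zero fun x hx => ?_
    have hd : HasDerivAt ψ (deriv ψ (x - ξ t)) (x - ξ t) :=
      (hψ.differentiable one_ne_zero _).hasDerivAt
    have hdξ : HasDerivAt ξ (deriv ξ t) t := (hξ.differentiable one_ne_zero _).hasDerivAt
    have d1 : HasDerivAt (fun s => ψ (x - ξ s)) (deriv ψ (x - ξ t) * (-deriv ξ t)) t :=
      hd.comp t (hdξ.const_sub x)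
    have d2 : HasDerivAt (fun x => ψ (x - ξ t)) (deriv ψ (x - ξ t)) x :=
      hd.comp_sub_const x (ξ t)
    simp only [d1.deriv, d2.deriv]
    rcases hξ' t ht with h | h
    · rw [h]; ring
    · rw [h x hx]; ring
  have key := hw.integral_eq_terminal hu hτ hφ hψ1
    (integrableOn_zero.congr_fun (fun t ht => (hF t ht).symm) measurableSet_Ioc)
  rw [setIntegral_congr_fun measurableSet_Ioc hF] at key
  simpa using key

end IsWeakSolution

/-- A continuous positive velocity on `[a, b]` has a globally defined increasing primitive. -/
lemma exists_strictMono_primitive {f : ℝ → ℝ} {a b : ℝ} (hab : a ≤ b)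
    (hf : ContinuousOn f (Icc a b)) (hpos : ∀ t ∈ Icc a b, 0 < f t) (t₀ : ℝ) :
    ∃ ξ : ℝ → ℝ, ContDiff ℝ 1 ξ ∧ StrictMono ξ ∧ (∀ t ∈ Icc a b, deriv ξ t = f t) ∧ ξ t₀ = 0 := by
  set g : ℝ → ℝ := IccExtend hab ((Icc a b).domRestrict f) with hg
  have hgc : Continuous g := (continuousOn_iff_continuous_domRestrict.1 hf).Icc_extend'
  have hgpos : ∀ t, 0 < g t := fun t => hpos _ (projIcc a b hab t).2
  have hd : ∀ t, HasDerivAt (fun t => ∫ s in t₀..t, g s) (g t) t := fun t =>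
    integral_hasDerivAt_right (hgc.intervalIntegrable _ _)
      (hgc.stronglyMeasurableAtFilter _ _) hgc.continuousAt
  refine ⟨fun t => ∫ s in t₀..t, g s, ?_, ?_, ?_, integral_same⟩
  · rw [contDiff_one_iff_deriv]
    refine ⟨fun t => (hd t).differentiableAt, ?_⟩
    rwa [show deriv (fun t => ∫ s in t₀..t, g s) = g from funext fun t => (hd t).deriv]
  · exact strictMono_of_deriv_pos fun t => by rw [(hd t).deriv]; exact hgpos t
  · intro t ht
    rw [(hd t).deriv, hg, IccExtend_of_mem hab _ ht]
    rfl

lemma exists_bump {c : ℝ} (hc : 0 < c) :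
    ∃ ψ : ℝ → ℝ, ContDiff ℝ 1 ψ ∧ (∀ y ≤ 0, ψ y = 0) ∧ (∀ y, c ≤ y → ψ y = 0) ∧
      ∃ m > 0, ∀ a ≤ 0, ∀ b, c ≤ b → ∫ y in a..b, ψ y = m := by
  set ψ : ℝ → ℝ := fun y => Real.smoothTransition y * Real.smoothTransition (c - y) with hψ
  have hC : ContDiff ℝ 1 ψ :=
    Real.smoothTransition.contDiff.mul
      (Real.smoothTransition.contDiff.comp (contDiff_const.sub contDiff_id))
  have hl : ∀ y ≤ 0, ψ y = 0 := fun y hy => by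
    simp [hψ, Real.smoothTransition.zero_of_nonpos hy]
  have hr : ∀ y, c ≤ y → ψ y = 0 := fun y hy => by
    simp [hψ, Real.smoothTransition.zero_of_nonpos (sub_nonpos.2 hy)]
  have hi : ∀ a b, IntervalIntegrable ψ volume a b := hC.continuous.intervalIntegrable
  refine ⟨ψ, hC, hl, hr, ∫ y in (0:ℝ)..c, ψ y, ?_, ?_⟩
  · refine intervalIntegral_pos_of_pos_on (hi _ _) (fun y hy => ?_) hc
    exact mul_pos (Real.smoothTransition.pos_of_pos hy.1)
      (Real.smoothTransition.pos_of_pos (sub_pos.2 hy.2))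
  · intro a ha b hb
    have h1 : ∫ y in a..0, ψ y = 0 := by
      refine integral_zero_ae (ae_of_all _ fun y hy => ?_)
      rw [uIoc_of_le ha] at hy
      exact hl y hy.2
    have h2 : ∫ y in c..b, ψ y = 0 := by
      refine integral_zero_ae (ae_of_all _ fun y hy => ?_)
      rw [uIoc_of_le hb] at hy
      exact hr y hy.1.le
    rw [← integral_add_adjacent_intervals (hi a 0) (hi 0 b),
      ← integral_add_adjacent_intervals (hi 0 c) (hi c b), h1, h2]
    ring

lemma setIntegral_Ioc_comp_sub (ψ : ℝ → ℝ) (a : ℝ) :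
    ∫ x in Ioc (0:ℝ) 1, ψ (x - a) = ∫ y in (-a)..(1 - a), ψ y := by
  rw [← intervalIntegral.integral_of_le zero_le_one,
    intervalIntegral.integral_comp_sub_right, zero_sub]

lemma exists_smooth_steps (c : ℝ) :
    ∃ ψ : ℕ → ℝ → ℝ, (∀ n, ContDiff ℝ 1 (ψ n)) ∧ (∀ n y, 0 ≤ ψ n y) ∧ (∀ n y, ψ n y ≤ 1) ∧
      (∀ n y, c ≤ y → ψ n y = 0) ∧ ∀ y < c, Tendsto (fun n => ψ n y) atTop (𝓝 1) := by
  refine ⟨fun n y => Real.smoothTransition (n * (c - y)), fun n => ?_,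
    fun n y => Real.smoothTransition.nonneg _, fun n y => Real.smoothTransition.le_one _,
    fun n y hy => ?_, fun y hy => ?_⟩
  · exact Real.smoothTransition.contDiff.comp
      (contDiff_const.mul (contDiff_const.sub contDiff_id))
  · exact Real.smoothTransition.zero_of_nonpos
      (mul_nonpos_of_nonneg_of_nonpos n.cast_nonneg (sub_nonpos.2 hy))
  · obtain ⟨N, hN⟩ := exists_nat_gt (1 / (c - y))
    refine tendsto_const_nhds.congr' ?_
    filter_upwards [eventually_ge_atTop N] with n hn
    have hpos : 0 < c - y := sub_pos.2 hy
    refine (Real.smoothTransition.one_of_one_le ?_).symm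
    rw [div_lt_iff₀ hpos] at hN
    have : (N : ℝ) ≤ n := Nat.cast_le.2 hn
    nlinarith

lemma tendsto_integral_mul_steps {f : ℝ → ℝ} (hf : IntegrableOn f (Ioc 0 1)) {a : ℝ}
    {ψ : ℕ → ℝ → ℝ} (hC : ∀ n, ContDiff ℝ 1 (ψ n)) (hnn : ∀ n y, 0 ≤ ψ n y)
    (hle : ∀ n y, ψ n y ≤ 1)
    (hlim : ∀ y < 1 - a, Tendsto (fun n => ψ n y) atTop (𝓝 1)) :
    Tendsto (fun n => ∫ x in Ioc (0:ℝ) 1, f x * ψ n (x - a)) atTop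
      (𝓝 (∫ x in Ioc (0:ℝ) 1, f x)) := by
  have hne : ∀ᵐ x ∂(volume.restrict (Ioc (0:ℝ) 1)), x ≠ 1 := ae_restrict_of_ae (by simp [ae_iff])
  have := tendsto_integral_mul_of_bounded measurableSet_Ioc hf (g₀ := fun _ => 1)
    (g := fun n x => ψ n (x - a)) 1
    (fun n => (hC n).continuous.comp (continuous_id.sub continuous_const))
    (fun n x _ => abs_le.2 ⟨by linarith [hnn n (x - a)], hle n (x - a)⟩) (by
      filter_upwards [ae_restrict_mem measurableSet_Ioc, hne] with x hx hne
      exact hlim _ (by linarith [lt_of_le_of_ne hx.2 hne]))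
  simpa using this

namespace IsWeakSolution

variable {lam : ℝ → ℝ} {T : ℝ} {ρ₀ u : ℝ → ℝ} {ρ : ℝ → ℝ → ℝ}

lemma mass_nonneg (hw : IsWeakSolution lam T ρ₀ u ρ) (hu : IntegrableOn u (Ioc 0 T))
    (hu0 : ∀ᵐ t ∂(volume.restrict (Ioc (0:ℝ) T)), 0 ≤ u t) (hρ₀ : ∀ x, 0 ≤ ρ₀ x)
    {τ : ℝ} (hτ : τ ∈ Ioc 0 T)
    (hf : ContinuousOn (fun t => lam (∫ y in Ioc (0:ℝ) 1, ρ t y)) (Icc 0 τ))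
    (hpos : ∀ t ∈ Icc 0 τ, 0 < lam (∫ y in Ioc (0:ℝ) 1, ρ t y)) :
    0 ≤ ∫ x in Ioc (0:ℝ) 1, ρ τ x := by
  obtain ⟨ξ, hξC, hξm, hξ', -⟩ := exists_strictMono_primitive hτ.1.le hf hpos 0
  obtain ⟨ψ, hC, hnn, hle, hz, hlim⟩ := exists_smooth_steps (1 - ξ τ)
  refine ge_of_tendsto' (tendsto_integral_mul_steps (hw.1 τ ⟨hτ.1.le, hτ.2⟩) hC hnn hle hlim)
    fun n => ?_
  rw [← hw.integral_comp_sub_characteristic hu hτ hξC (hC n)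
    (fun t ht => Or.inl (hξ' t ⟨ht.1.le, ht.2⟩))
    (fun t ht => hz n _ (sub_le_sub_left (hξm.monotone ht.2) _))]
  refine add_nonneg ?_ (integral_nonneg fun x => mul_nonneg (hρ₀ x) (hnn _ _))
  refine integral_nonneg_of_ae ?_
  filter_upwards [ae_restrict_of_ae_restrict_of_subset (Ioc_subset_Ioc_right hτ.2) hu0] with t ht
  exact mul_nonneg ht (hnn _ _)

/-- Without influx, the state near the inflow boundary is zero once the velocity is positive. -/
lemma eq_zero_of_influx_eq_zero (hw : IsWeakSolution lam T ρ₀ u ρ)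
    (hu0 : ∀ᵐ t ∂(volume.restrict (Ioc (0:ℝ) T)), u t = 0)
    {a : ℝ} (ha : 0 ≤ a) (haT : a < T)
    (hf : ContinuousOn (fun t => lam (∫ y in Ioc (0:ℝ) 1, ρ t y)) (Icc a T))
    (hpos : ∀ t ∈ Icc a T, 0 < lam (∫ y in Ioc (0:ℝ) 1, ρ t y))
    {r : ℝ} (hr : ∀ᵐ x ∂(volume.restrict (Ioc (0:ℝ) 1)), ρ T x = r) : r = 0 := by
  obtain ⟨ξ, hξC, hξm, hξ', hξT⟩ := exists_strictMono_primitive haT.le hf hpos T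
  have hξa : ξ a < 0 := hξT ▸ hξm haT
  have hc : 0 < min 1 (-ξ a) := lt_min one_pos (by linarith)
  obtain ⟨ψ, hC, hl, hz, m, hm, hint⟩ := exists_bump hc
  have hu : IntegrableOn u (Ioc 0 T) := (integrable_zero ℝ ℝ _).congr (hu0.mono fun t ht => ht.symm)
  have key := hw.integral_comp_sub_characteristic hu ⟨ha.trans_lt haT, le_rfl⟩ hξC hC ?_ ?_
  · have e1 : ∫ t in Ioc (0:ℝ) T, u t * ψ (0 - ξ t) = 0 := by
      refine integral_eq_zero_of_ae ?_
      filter_upwards [hu0] with t ht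
      simp [ht]
    have e2 : ∫ x in Ioc (0:ℝ) 1, ρ₀ x * ψ (x - ξ 0) = 0 := by
      refine setIntegral_eq_zero_of_forall_eq_zero fun x hx => ?_
      rw [hz, mul_zero]
      exact (min_le_right _ _).trans (by linarith [hξm.monotone ha, hx.1])
    have e3 : ∫ x in Ioc (0:ℝ) 1, ρ T x * ψ (x - ξ T) = r * m := by
      rw [← hint (-ξ T) (by simp [hξT]) (1 - ξ T) (by simp [hξT]), ← setIntegral_Ioc_comp_sub,
        ← MeasureTheory.integral_const_mul]
      refine integral_congr_ae ?_
      filter_upwards [hr] with x hx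
      rw [hx]
    rw [e1, e2, e3, add_zero] at key
    rcases mul_eq_zero.1 key.symm with h | h
    · exact h
    · exact absurd h hm.ne'
  · intro t ht
    rcases le_total a t with hat | hat
    · exact Or.inl (hξ' t ⟨hat, ht.2⟩)
    · refine Or.inr fun x hx => ?_
      have hlt : min 1 (-ξ a) < x - ξ t :=
        (min_le_right _ _).trans_lt (by linarith [hξm.monotone hat, hx.1])
      have : ψ =ᶠ[𝓝 (x - ξ t)] fun _ => 0 := by
        filter_upwards [lt_mem_nhds hlt] with y hy using hz y hy.le
      rw [this.deriv_eq, deriv_const]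
  · intro t ht
    have := hξm.monotone ht.2
    exact hz _ ((min_le_left _ _).trans (by linarith))

end IsWeakSolution

lemma tendsto_setIntegral_Ioc_nhdsGT {g : ℝ → ℝ} {ε : ℝ} (hε : 0 < ε)
    (hg : IntegrableOn g (Ioc 0 ε)) :
    Tendsto (fun τ => ∫ t in Ioc 0 τ, g t) (𝓝[Ioc 0 ε] 0) (𝓝 0) := by
  have hg' : IntegrableOn g (Icc 0 ε) := by rwa [integrableOn_Icc_iff_integrableOn_Ioc]
  have := continuousOn_primitive hg' 0 (left_mem_Icc.2 hε.le)
  simpa [ContinuousWithinAt] using this.mono Ioc_subset_Icc_self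

/-- A function continuous on `[0, T]` that is positive at `0` is positive on some `[0, ε]`. -/
lemma exists_pos_on_Icc_left {g : ℝ → ℝ} {T : ℝ} (hT : 0 < T) (hg : ContinuousOn g (Icc 0 T))
    (h0 : 0 < g 0) : ∃ ε, 0 < ε ∧ ε ≤ T ∧ ∀ t ∈ Icc 0 ε, 0 < g t := by
  have h := (hg 0 (left_mem_Icc.2 hT.le)).eventually (lt_mem_nhds h0)
  obtain ⟨δ, hδ, H⟩ := Metric.mem_nhdsWithin_iff.1 h
  refine ⟨min (δ / 2) T, lt_min (by positivity) hT, min_le_right _ _, fun t ht => H ⟨?_, ht.1,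
    ht.2.trans (min_le_right _ _)⟩⟩
  rw [Metric.mem_ball, Real.dist_eq, sub_zero, abs_of_nonneg ht.1]
  linarith [ht.2.trans (min_le_left _ _)]

/-- A function continuous on `[0, T]` that is positive at `T` is positive on some `[a, T]`. -/
lemma exists_pos_on_Icc_right {g : ℝ → ℝ} {T : ℝ} (hT : 0 < T) (hg : ContinuousOn g (Icc 0 T))
    (h0 : 0 < g T) : ∃ a, 0 ≤ a ∧ a < T ∧ ∀ t ∈ Icc a T, 0 < g t := by
  have hc : ContinuousOn (fun t => g (T - t)) (Icc 0 T) :=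
    hg.comp (by fun_prop) fun t ht => ⟨by linarith [ht.2], by linarith [ht.1]⟩
  obtain ⟨ε, hε, hεT, H⟩ := exists_pos_on_Icc_left hT hc (by simpa using h0)
  refine ⟨T - ε, by linarith, by linarith, fun t ht => ?_⟩
  simpa using H (T - t) ⟨by linarith [ht.2], by linarith [ht.1]⟩

namespace IsWeakSolution

variable {T : ℝ} {ρ₀ u : ℝ → ℝ} {ρ : ℝ → ℝ → ℝ}

lemma initial_mass {lam : ℝ → ℝ} (hw : IsWeakSolution lam T ρ₀ u ρ)
    (hu : IntegrableOn u (Ioc 0 T)) (hρ₀ : IntegrableOn ρ₀ (Ioc 0 1)) {ε : ℝ} (hε : 0 < ε)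
    (hεT : ε ≤ T) (hf : IntegrableOn (fun t => lam (∫ y in Ioc (0:ℝ) 1, ρ t y)) (Ioc 0 ε)) :
    ∫ x in Ioc (0:ℝ) 1, ρ 0 x = ∫ x in Ioc (0:ℝ) 1, ρ₀ x := by
  have h0T : (0:ℝ) ∈ Icc 0 T := ⟨le_rfl, hε.le.trans hεT⟩
  have main : ∀ ψ : ℝ → ℝ, ContDiff ℝ 1 ψ → ψ 1 = 0 →
      ∫ x in Ioc (0:ℝ) 1, ρ₀ x * ψ x = ∫ x in Ioc (0:ℝ) 1, ρ 0 x * ψ x := by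
    intro ψ hψ hψ1
    have hφ : ContDiff ℝ 1 (Function.uncurry fun _ x : ℝ => ψ x) := hψ.comp contDiff_snd
    have hB : ContinuousOn (fun t => ∫ x in Ioc (0:ℝ) 1, ρ t x * deriv ψ x) (Icc 0 T) :=
      hw.continuousOn_integral_mul (h := fun _ x => deriv ψ x)
        ((hψ.continuous_deriv le_rfl).comp continuous_snd)
    have hF : IntegrableOn (fun t => ∫ x in Ioc (0:ℝ) 1, ρ t x * (deriv (fun _ : ℝ => ψ x) t
        + lam (∫ y in Ioc (0:ℝ) 1, ρ t y) * deriv ψ x)) (Ioc 0 ε) := by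
      refine (integrableOn_mul_of_continuousOn hf (hB.mono (Icc_subset_Icc_right hεT))).congr_fun
        (fun t _ => ?_) measurableSet_Ioc
      dsimp only
      rw [← MeasureTheory.integral_const_mul]
      congr 1
      ext x
      rw [deriv_const]
      ring
    have key : ∀ τ ∈ Ioc 0 ε, _ := fun τ hτ => hw.integral_eq_terminal hu
      ⟨hτ.1, hτ.2.trans hεT⟩ hφ (fun _ _ => hψ1) (hF.mono_set (Ioc_subset_Ioc_right hτ.2))
    have l1 := tendsto_setIntegral_Ioc_nhdsGT hε hF
    have l2 := tendsto_setIntegral_Ioc_nhdsGT hε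
      ((hu.mono_set (Ioc_subset_Ioc_right hεT)).mul_const (ψ 0))
    have l3 : Tendsto (fun τ => ∫ x in Ioc (0:ℝ) 1, ρ τ x * ψ x) (𝓝[Ioc 0 ε] 0)
        (𝓝 (∫ x in Ioc (0:ℝ) 1, ρ 0 x * ψ x)) :=
      (hw.continuousOn_integral_mul (h := fun _ x => ψ x) hφ.continuous 0 h0T).mono_left
        (nhdsWithin_mono _ fun t ht => ⟨ht.1.le, ht.2.trans hεT⟩)
    have l4 := (l1.add l2).add_const (∫ x in Ioc (0:ℝ) 1, ρ₀ x * ψ x)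
    have : (𝓝[Ioc 0 ε] (0:ℝ)).NeBot := left_nhdsWithin_Ioc_neBot hε
    have := tendsto_nhds_unique (l4.congr' (by
      filter_upwards [self_mem_nhdsWithin] with τ hτ using key τ hτ)) l3
    simpa using this
  obtain ⟨ψ, hC, hnn, hle, hz, hlim⟩ := exists_smooth_steps (1 - 0)
  have l1 := tendsto_integral_mul_steps (hw.1 0 h0T) hC hnn hle hlim
  have l2 := tendsto_integral_mul_steps hρ₀ hC hnn hle hlim
  refine tendsto_nhds_unique l1 (l2.congr fun n => ?_)
  simpa using main (ψ n) (hC n) (hz n 1 (by simp))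

/-- If the velocity fails to be integrable at the initial time, the weak formulation forces the
influx to vanish. -/
lemma influx_eq_zero_of_not_integrableOn
    (hw : IsWeakSolution (fun W => 1 / (1 + W)) T ρ₀ u ρ) (hT : 0 < T)
    (hu : IntegrableOn u (Ioc 0 T)) (hu0 : ∀ᵐ t ∂(volume.restrict (Ioc (0:ℝ) T)), 0 ≤ u t)
    (hρ₀ : ∀ x, 0 ≤ ρ₀ x)
    (hf : ∀ ε, 0 < ε → ε ≤ T →
      ¬ IntegrableOn (fun t => 1 / (1 + ∫ y in Ioc (0:ℝ) 1, ρ t y)) (Ioc 0 ε)) :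
    ∀ᵐ t ∂(volume.restrict (Ioc (0:ℝ) T)), u t = 0 := by
  set W : ℝ → ℝ := fun t => ∫ y in Ioc (0:ℝ) 1, ρ t y with hW
  have hWc : ContinuousOn W (Icc 0 T) := hw.continuousOn_mass
  have hW0 : 1 + W 0 = 0 := by
    by_contra hne
    obtain ⟨ε, hε, hεT, H⟩ := exists_pos_on_Icc_left hT
      (g := fun t => |1 + W t|) (by fun_prop) (abs_pos.2 hne)
    refine hf ε hε hεT (ContinuousOn.integrableOn_Icc ?_ |>.mono_set Ioc_subset_Icc_self)
    exact continuousOn_const.div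
      (continuousOn_const.add (hWc.mono (Icc_subset_Icc_right hεT)))
      fun t ht => abs_pos.1 (H t ht)
  obtain ⟨ε, hε, hεT, H⟩ := exists_pos_on_Icc_left hT
      (g := fun t => -((1 - t / T) * W t)) (by fun_prop) (by simp; linarith)
  have hχC : ContDiff ℝ 1 (fun t : ℝ => 1 - t / T) := by fun_prop
  have key := hw.2.2 T ⟨hT.le, le_rfl⟩ (fun t x => (1 - t / T) * (x - 1))
    ((hχC.comp contDiff_fst).mul (contDiff_snd.sub contDiff_const))
    (fun x _ => by simp [hT.ne']) (fun t _ => by simp)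
  set M : ℝ → ℝ := fun t => ∫ x in Ioc (0:ℝ) 1, ρ t x * (x - 1) with hM
  have hMc : ContinuousOn M (Icc 0 T) :=
    hw.continuousOn_integral_mul (h := fun _ x => x - 1) (continuous_snd.sub continuous_const)
  have e1 : ∀ t ∈ Ioc 0 T, (∫ x in Ioc (0:ℝ) 1,
      ρ t x * (deriv (fun s => (1 - s / T) * (x - 1)) t
        + 1 / (1 + ∫ y in Ioc (0:ℝ) 1, ρ t y) * deriv (fun x => (1 - t / T) * (x - 1)) x))
      = -(1 / T) * M t + 1 / (1 + W t) * ((1 - t / T) * W t) := by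
    intro t ht
    have htT : t ∈ Icc 0 T := ⟨ht.1.le, ht.2⟩
    change _ = -(1 / T) * (∫ x in Ioc (0:ℝ) 1, ρ t x * (x - 1))
      + 1 / (1 + W t) * ((1 - t / T) * ∫ x in Ioc (0:ℝ) 1, ρ t x)
    rw [← MeasureTheory.integral_const_mul, ← mul_assoc, ← MeasureTheory.integral_const_mul,
      ← MeasureTheory.integral_add]
    · congr 1
      ext x
      have d1 : HasDerivAt (fun s : ℝ => (1 - s / T) * (x - 1)) (-(1 / T) * (x - 1)) t :=
        (((hasDerivAt_id' t).div_const T).const_sub 1).mul_const _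
      have d2 : HasDerivAt (fun x : ℝ => (1 - t / T) * (x - 1)) ((1 - t / T) * 1) x :=
        ((hasDerivAt_id' x).sub_const 1).const_mul _
      rw [d1.deriv, d2.deriv]
      ring
    · exact (integrableOn_mul_of_continuous (hw.1 t htT)
        (continuous_id.sub continuous_const)).const_mul _
    · exact (hw.1 t htT).const_mul _
  have hni : ¬ IntegrableOn (fun t => ∫ x in Ioc (0:ℝ) 1,
      ρ t x * (deriv (fun s => (1 - s / T) * (x - 1)) t
        + 1 / (1 + ∫ y in Ioc (0:ℝ) 1, ρ t y) * deriv (fun x => (1 - t / T) * (x - 1)) x))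
      (Ioc 0 T) := by
    intro hi
    refine hf ε hε hεT ?_
    have h1 := hi.congr_fun e1 measurableSet_Ioc
    have h2 : IntegrableOn (fun t => -(1 / T) * M t) (Ioc 0 T) :=
      (hMc.integrableOn_Icc.mono_set Ioc_subset_Icc_self).const_mul _
    have h3 : IntegrableOn (fun t => 1 / (1 + W t) * ((1 - t / T) * W t)) (Ioc 0 T) := by
      exact (h1.sub h2).congr_fun (fun t _ => by simp only [Pi.sub_apply]; ring) measurableSet_Ioc
    have h4 := integrableOn_mul_of_continuousOn (g := fun t => ((1 - t / T) * W t)⁻¹)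
      (h3.mono_set (Ioc_subset_Ioc_right hεT)) (ContinuousOn.inv₀
        (ContinuousOn.mul (by fun_prop) (hWc.mono (Icc_subset_Icc_right hεT)))
        fun t ht => by have := H t ht; intro h; linarith)
    refine h4.congr_fun (fun t ht => ?_) measurableSet_Ioc
    have := H t ⟨ht.1.le, ht.2⟩
    exact mul_inv_cancel_right₀ (by intro h; linarith) _
  rw [integral_undef hni, zero_add] at key
  have hneg : ∫ x in Ioc (0:ℝ) 1, ρ₀ x * ((1 - 0 / T) * (x - 1)) ≤ 0 := by
    refine integral_nonpos_of_ae ?_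
    filter_upwards [ae_restrict_mem measurableSet_Ioc] with x hx
    exact mul_nonpos_of_nonneg_of_nonpos (hρ₀ x) (by simp; exact hx.2)
  have hnn : 0 ≤ᵐ[volume.restrict (Ioc (0:ℝ) T)] fun t => u t * (1 - t / T) := by
    filter_upwards [hu0, ae_restrict_mem measurableSet_Ioc] with t ht htm
    exact mul_nonneg ht (sub_nonneg.2 ((div_le_one hT).2 htm.2))
  have hI : ∫ t in Ioc (0:ℝ) T, u t * (1 - t / T) = 0 := by
    refine le_antisymm ?_ (integral_nonneg_of_ae hnn)
    have : ∫ t in Ioc (0:ℝ) T, u t * ((1 - t / T) * (0 - 1))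
        = -∫ t in Ioc (0:ℝ) T, u t * (1 - t / T) := by
      rw [← MeasureTheory.integral_neg]; congr 1; ext t; ring
    linarith
  have hz := (integral_eq_zero_iff_of_nonneg_ae hnn
    (integrableOn_mul_of_continuous hu hχC.continuous)).1 hI
  have hne : ∀ᵐ t ∂(volume.restrict (Ioc 0 T)), t ≠ T := ae_restrict_of_ae (by simp [ae_iff])
  filter_upwards [hz, hne, ae_restrict_mem measurableSet_Ioc] with t ht hne htm
  refine (mul_eq_zero.1 ht).resolve_right (sub_pos.2 ?_).ne'
  exact (div_lt_one hT).2 (lt_of_le_of_ne htm.2 hne)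

end IsWeakSolution

namespace IsWeakSolution

variable {T ρ0 ρ1 : ℝ} {u : ℝ → ℝ} {ρ : ℝ → ℝ → ℝ}

/-- The mass of a nonnegative solution stays above the singular value `-1` of the velocity. -/
lemma one_add_mass_pos {ρ₀ : ℝ → ℝ} (hw : IsWeakSolution (fun W => 1 / (1 + W)) T ρ₀ u ρ)
    (hu : IntegrableOn u (Ioc 0 T))
    (hu0 : ∀ᵐ t ∂(volume.restrict (Ioc (0:ℝ) T)), 0 ≤ u t) (hρ₀ : ∀ x, 0 ≤ ρ₀ x)
    (h0 : 0 ≤ ∫ x in Ioc (0:ℝ) 1, ρ 0 x) :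
    ∀ t ∈ Icc 0 T, 0 < 1 + ∫ x in Ioc (0:ℝ) 1, ρ t x := by
  set W : ℝ → ℝ := fun t => ∫ x in Ioc (0:ℝ) 1, ρ t x with hW
  have hWc : ContinuousOn W (Icc 0 T) := hw.continuousOn_mass
  by_contra! hex
  set S : Set ℝ := Icc 0 T ∩ W ⁻¹' Iic (-1) with hS
  have hSne : S.Nonempty := by
    obtain ⟨t, ht, hle⟩ := hex
    exact ⟨t, ht, by change W t ≤ -1; linarith⟩
  have hSc : IsClosed S := hWc.preimage_isClosed_of_isClosed isClosed_Icc isClosed_Iic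
  have hSb : BddBelow S := ⟨0, fun t ht => ht.1.1⟩
  have hmem : sInf S ∈ S := hSc.csInf_mem hSne hSb
  set s := sInf S with hs
  have hle : W s ≤ -1 := hmem.2
  have hs0 : 0 < s := lt_of_le_of_ne hmem.1.1 fun h => by
    rw [← h] at hle
    exact absurd h0 (by change ¬ 0 ≤ W 0; linarith)
  have hlt : ∀ t ∈ Ico 0 s, 0 < 1 + W t := fun t ht => by
    by_contra! hn
    have htS : t ∈ S := ⟨⟨ht.1, ht.2.le.trans hmem.1.2⟩, by change W t ≤ -1; linarith⟩
    exact absurd (csInf_le hSb htS) (not_le.2 ht.2)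
  have hnn : ∀ t ∈ Ioo 0 s, 0 ≤ W t := fun t ht => by
    refine hw.mass_nonneg hu hu0 hρ₀ ⟨ht.1, ht.2.le.trans hmem.1.2⟩ ?_ ?_
    · exact continuousOn_const.div (continuousOn_const.add
        (hWc.mono (Icc_subset_Icc_right (ht.2.le.trans hmem.1.2))))
        fun r hr => (hlt r ⟨hr.1, hr.2.trans_lt ht.2⟩).ne'
    · exact fun r hr => one_div_pos.2 (hlt r ⟨hr.1, hr.2.trans_lt ht.2⟩)
  have hlim : Tendsto W (𝓝[Ioo 0 s] s) (𝓝 (W s)) :=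
    (hWc s hmem.1).mono_left (nhdsWithin_mono _ fun t ht => ⟨ht.1.le, ht.2.le.trans hmem.1.2⟩)
  have : (𝓝[Ioo 0 s] s).NeBot := right_nhdsWithin_Ioo_neBot hs0
  have := ge_of_tendsto hlim (by filter_upwards [self_mem_nhdsWithin] with t ht using hnn t ht)
  linarith

/-- Every transfer from `ρ0` to `ρ1` takes at least the time `1 + (ρ0 + ρ1) / 2`. -/
lemma le_transfer_time (hw : IsWeakSolution (fun W => 1 / (1 + W)) T (fun _ => ρ0) u ρ)
    (h0 : 0 ≤ ρ0) (h01 : ρ0 < ρ1) (hT : 0 < T) (hu : IntegrableOn u (Ioc 0 T))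
    (hu0 : ∀ᵐ t ∂(volume.restrict (Ioc (0:ℝ) T)), 0 ≤ u t)
    (hr : ∀ᵐ x ∂(volume.restrict (Ioc (0:ℝ) 1)), ρ T x = ρ1) :
    1 + (ρ0 + ρ1) / 2 ≤ T := by
  set W : ℝ → ℝ := fun t => ∫ x in Ioc (0:ℝ) 1, ρ t x with hW
  have hWc : ContinuousOn W (Icc 0 T) := hw.continuousOn_mass
  have hmul : ∀ g : ℝ → ℝ,
      ∫ x in Ioc (0:ℝ) 1, ρ T x * g x = ρ1 * ∫ x in Ioc (0:ℝ) 1, g x := fun g => by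
    rw [← MeasureTheory.integral_const_mul]
    exact integral_congr_ae (by filter_upwards [hr] with x hx; rw [hx])
  have hWT : W T = ρ1 := by simpa using hmul fun _ => 1
  have hTT : T ∈ Ioc 0 T := ⟨hT, le_rfl⟩
  by_cases hf : ∀ ε, 0 < ε → ε ≤ T →
      ¬ IntegrableOn (fun t => 1 / (1 + ∫ y in Ioc (0:ℝ) 1, ρ t y)) (Ioc 0 ε)
  · have huz := hw.influx_eq_zero_of_not_integrableOn hT hu hu0 (fun _ => h0) hf
    obtain ⟨a, ha, haT, H⟩ := exists_pos_on_Icc_right hT (g := fun t => 1 + W t)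
      (by fun_prop) (by rw [hWT]; linarith)
    have := hw.eq_zero_of_influx_eq_zero huz ha haT (continuousOn_const.div
      (continuousOn_const.add (hWc.mono (Icc_subset_Icc_left ha))) fun t ht => (H t ht).ne')
      (fun t ht => one_div_pos.2 (H t ht)) hr
    linarith
  push Not at hf
  obtain ⟨ε, hε, hεT, hi⟩ := hf
  have hW0 : W 0 = ρ0 := by simpa using hw.initial_mass hu (by simp) hε hεT hi
  have hpos : ∀ t ∈ Icc 0 T, 0 < 1 + W t :=
    hw.one_add_mass_pos hu hu0 (fun _ => h0) (h0.trans_eq hW0.symm)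
  set f : ℝ → ℝ := fun t => 1 / (1 + W t) with hf
  have hfc : ContinuousOn f (Icc 0 T) := continuousOn_const.div
    (continuousOn_const.add hWc) fun t ht => (hpos t ht).ne'
  obtain ⟨ξ, hξC, hξm, hξ', hξ0⟩ :=
    exists_strictMono_primitive hT.le hfc (fun t ht => one_div_pos.2 (hpos t ht)) 0
  have hξ0T : 0 < ξ T := hξ0 ▸ hξm hT
  have hchar : ∀ t ∈ Ioc 0 T, deriv ξ t = f t := fun t ht => hξ' t ⟨ht.1.le, ht.2⟩
  have hξT : 1 ≤ ξ T := by
    by_contra! hlt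
    obtain ⟨ψ, hC, hl, hz, m, hm, hint⟩ := exists_bump (sub_pos.2 hlt)
    have key := hw.integral_comp_sub_characteristic hu hTT hξC hC
      (fun t ht => Or.inl (hchar t ht))
      (fun t ht => hz _ (sub_le_sub_left (hξm.monotone ht.2) _))
    have e1 : ∫ t in Ioc (0:ℝ) T, u t * ψ (0 - ξ t) = 0 := by
      refine setIntegral_eq_zero_of_forall_eq_zero fun t ht => ?_
      rw [hl, mul_zero]
      linarith [hξm ht.1]
    rw [e1, zero_add, hmul, MeasureTheory.integral_const_mul, setIntegral_Ioc_comp_sub,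
      setIntegral_Ioc_comp_sub, hint _ (by linarith) _ (by linarith),
      hint _ (by linarith) _ (by linarith)] at key
    exact h01.ne (mul_right_cancel₀ hm.ne' key)
  have hflux : ρ1 ≤ ∫ t in Ioc (0:ℝ) T, u t := by
    obtain ⟨ψ, hC, hnn, hle, hz, hlim⟩ := exists_smooth_steps (1 - ξ T)
    have l := tendsto_integral_mul_steps (hw.1 T ⟨hT.le, le_rfl⟩) hC hnn hle hlim
    rw [← hWT]
    refine le_of_tendsto' l fun n => ?_
    rw [← hw.integral_comp_sub_characteristic hu hTT hξC (hC n)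
      (fun t ht => Or.inl (hchar t ht))
      (fun t ht => hz n _ (sub_le_sub_left (hξm.monotone ht.2) _))]
    have e2 : ∫ x in Ioc (0:ℝ) 1, ρ0 * ψ n (x - ξ 0) = 0 := by
      refine setIntegral_eq_zero_of_forall_eq_zero fun x hx => ?_
      rw [hz, mul_zero]
      linarith [hx.1]
    rw [e2, add_zero]
    refine integral_mono_ae (integrableOn_mul_of_continuous hu
      ((hC n).continuous.comp (continuous_const.sub hξC.continuous))) hu ?_
    filter_upwards [hu0] with t ht using mul_le_of_le_one_right ht (hle n _)
  have hD : ∀ t x : ℝ, deriv (fun _ : ℝ => x - 1) t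
      + f t * deriv (fun x : ℝ => x - 1) x = f t := fun t x => by
    rw [deriv_const, ((hasDerivAt_id' x).sub_const 1).deriv]
    ring
  have hF : ∀ t, ∫ x in Ioc (0:ℝ) 1, ρ t x * (deriv (fun _ : ℝ => x - 1) t
      + f t * deriv (fun x : ℝ => x - 1) x) = W t * f t := fun t => by
    simp only [hD]
    exact MeasureTheory.integral_mul_const _ _
  have hFi : IntegrableOn (fun t => W t * f t) (Ioc 0 T) :=
    (hWc.mul hfc).integrableOn_Icc.mono_set Ioc_subset_Icc_self
  have hfi : IntegrableOn f (Ioc 0 T) := hfc.integrableOn_Icc.mono_set Ioc_subset_Icc_self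
  have bal := hw.integral_eq_terminal hu hTT (φ := fun _ x => x - 1)
    (contDiff_snd.sub contDiff_const) (fun _ _ => sub_self 1)
    (hFi.congr_fun (fun t _ => (hF t).symm) measurableSet_Ioc)
  have hx : ∫ x in Ioc (0:ℝ) 1, (x - 1) = -(1 / 2) := by
    rw [← intervalIntegral.integral_of_le zero_le_one]
    norm_num
  have bal' : (∫ t in Ioc (0:ℝ) T, W t * f t) + (∫ t in Ioc (0:ℝ) T, u t) * (0 - 1)
      + ρ0 * -(1 / 2) = ρ1 * -(1 / 2) := by
    rw [← hx, ← hmul, ← bal, ← MeasureTheory.integral_mul_const,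
      ← MeasureTheory.integral_const_mul]
    congr 2
    exact integral_congr_ae (ae_of_all _ fun t => (hF t).symm)
  have hfint : ∫ t in Ioc (0:ℝ) T, f t = ξ T := by
    rw [← setIntegral_congr_fun measurableSet_Ioc hchar,
      ← intervalIntegral.integral_of_le hT.le, integral_deriv_eq_sub
        (fun t _ => hξC.differentiable one_ne_zero t)
        ((hξC.continuous_deriv le_rfl).intervalIntegrable _ _), hξ0, sub_zero]
  have htime : (∫ t in Ioc (0:ℝ) T, W t * f t) + ∫ t in Ioc (0:ℝ) T, f t = T := by
    rw [← MeasureTheory.integral_add hFi hfi]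
    have : ∀ t ∈ Ioc 0 T, W t * f t + f t = 1 := fun t ht => by
      have := (hpos t ⟨ht.1.le, ht.2⟩).ne'
      rw [hf]
      field_simp
      ring
    rw [setIntegral_congr_fun measurableSet_Ioc this]
    simp [hT.le]
  linarith

end IsWeakSolution

section MovingEndpoint

variable {φ : ℝ → ℝ → ℝ}

lemma hasDerivAt_integral_const_endpoint (hφ : ContDiff ℝ 1 (Function.uncurry φ)) (t a b : ℝ) :
    HasDerivAt (fun s => ∫ x in a..b, φ s x) (∫ x in a..b, deriv (fun s => φ s x) t) t := by
  have hsec : ∀ s, Continuous (φ s) := fun s => hφ.continuous.comp (Continuous.prodMk_right s)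
  have hd := continuous_deriv_fst hφ
  obtain ⟨C, hC⟩ := ((isCompact_Icc (a := t - 1) (b := t + 1)).prod
    (isCompact_uIcc (a := a) (b := b))).exists_bound_of_continuousOn hd.continuousOn
  refine (hasDerivAt_integral_of_dominated_loc_of_deriv_le
    (F' := fun s x => deriv (fun s => φ s x) s) (bound := fun _ => C)
    (Icc_mem_nhds (sub_one_lt t) (lt_add_one t))
    (.of_forall fun s => (hsec s).aestronglyMeasurable) ((hsec t).intervalIntegrable _ _)
    (hd.comp (Continuous.prodMk_right t)).aestronglyMeasurable ?_ intervalIntegrable_const ?_).2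
  · exact ae_of_all _ fun x hx s hs => hC (s, x) ⟨hs, uIoc_subset_uIcc hx⟩
  · exact ae_of_all _ fun x _ s _ => hasDerivAt_fst hφ s x

/-- The Leibniz rule for an integral with one moving endpoint. -/
lemma hasDerivAt_integral_moving_endpoint (hφ : ContDiff ℝ 1 (Function.uncurry φ)) {ξ : ℝ → ℝ}
    {t v a : ℝ} (hξ : HasDerivAt ξ v t) :
    HasDerivAt (fun s => ∫ x in a..ξ s, φ s x)
      ((∫ x in a..ξ t, deriv (fun s => φ s x) t) + v * φ t (ξ t)) t := by
  have hsec : ∀ s, Continuous (φ s) := fun s => hφ.continuous.comp (Continuous.prodMk_right s)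
  have hlin : ∀ {g : ℝ → ℝ} {g' x : ℝ}, HasDerivAt g g' x →
      HasFDerivAt g (g' • (1 : ℝ →L[ℝ] ℝ)) x := fun h =>
    h.hasFDerivAt.congr_fderiv (by ext; simp)
  have h := hasStrictFDerivAt_uncurry_coprod (𝕜 := ℝ) (u := (t, ξ t))
    (f := fun s z => ∫ x in a..z, φ s x)
    (f₁ := fun s z => (∫ x in a..z, deriv (fun s => φ s x) s) • (1 : ℝ →L[ℝ] ℝ))
    (f₂ := fun s z => φ s z • (1 : ℝ →L[ℝ] ℝ))
    (.of_forall fun p => hlin (hasDerivAt_integral_const_endpoint hφ p.1 a p.2))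
    (.of_forall fun p => hlin (integral_hasDerivAt_right ((hsec p.1).intervalIntegrable _ _)
      ((hsec p.1).stronglyMeasurableAtFilter _ _) (hsec p.1).continuousAt))
    ((continuous_parametric_primitive_of_continuous
      (continuous_deriv_fst hφ)).smul continuous_const).continuousAt
    (hφ.continuous.smul continuous_const).continuousAt
  have hc := h.hasFDerivAt.comp_hasDerivAt t ((hasDerivAt_id' t).prodMk hξ)
  exact hc.congr_deriv (by simp [Function.HasUncurry.uncurry, mul_comm])

end MovingEndpoint

/-- The two-state profile with value `r₁` up to `a` and `r₀` beyond. -/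
def stepProfile (r₀ r₁ a x : ℝ) : ℝ := if x ≤ a then r₁ else r₀

section StepProfile

variable {r₀ r₁ : ℝ}

lemma stepProfile_eq_indicator (a x : ℝ) :
    stepProfile r₀ r₁ a x = (Iic a).indicator (fun _ => r₁ - r₀) x + r₀ := by
  by_cases h : x ≤ a <;> simp [stepProfile, h]

lemma integrableOn_stepProfile (a : ℝ) : IntegrableOn (stepProfile r₀ r₁ a) (Ioc 0 1) := by
  simp only [funext (stepProfile_eq_indicator a)]
  exact (IntegrableOn.integrable (by simp) |>.indicator measurableSet_Iic).add (by simp)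

lemma integral_stepProfile_mul {a : ℝ} (ha : a ∈ Icc 0 1) {g : ℝ → ℝ} (hg : Continuous g) :
    ∫ x in Ioc (0:ℝ) 1, stepProfile r₀ r₁ a x * g x
      = (r₁ - r₀) * (∫ x in (0:ℝ)..a, g x) + r₀ * ∫ x in (0:ℝ)..1, g x := by
  have hgi : IntegrableOn g (Ioc 0 1) := hg.integrableOn_Ioc
  have : ∀ x, stepProfile r₀ r₁ a x * g x
      = (Iic a).indicator (fun x => (r₁ - r₀) * g x) x + r₀ * g x := fun x => by
    by_cases h : x ≤ a <;> simp [stepProfile, h]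
    ring
  simp only [this]
  rw [MeasureTheory.integral_add ((hgi.const_mul _).indicator measurableSet_Iic)
    (hgi.const_mul _), setIntegral_indicator measurableSet_Iic, Ioc_inter_Iic, min_eq_right ha.2,
    MeasureTheory.integral_const_mul, MeasureTheory.integral_const_mul,
    intervalIntegral.integral_of_le ha.1, intervalIntegral.integral_of_le zero_le_one]

lemma integral_abs_stepProfile_sub_le (a b : ℝ) :
    ∫ x in Ioc (0:ℝ) 1, |stepProfile r₀ r₁ b x - stepProfile r₀ r₁ a x|
      ≤ |r₁ - r₀| * |b - a| := by
  have h : ∀ x, |stepProfile r₀ r₁ b x - stepProfile r₀ r₁ a x|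
      = (uIoc a b).indicator (fun _ => |r₁ - r₀|) x := fun x => by
    by_cases hb : x ≤ b <;> by_cases ha : x ≤ a <;>
      simp [stepProfile, ha, hb, indicator, mem_uIoc, abs_sub_comm r₀ r₁, not_lt.2, lt_of_not_ge]
  have hi : Integrable ((uIoc a b).indicator fun _ : ℝ => |r₁ - r₀|) :=
    (integrable_indicator_iff measurableSet_uIoc).2 (by simp [uIoc])
  simp only [h]
  refine (setIntegral_le_integral hi
    (ae_of_all _ fun x => indicator_nonneg (fun _ _ => abs_nonneg _) x)).trans_eq ?_
  rw [MeasureTheory.integral_indicator measurableSet_uIoc]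
  simp [mul_comm, uIoc, measureReal_def, max_sub_min_eq_abs, abs_sub_comm]

/-- A step profile whose jump moves along the characteristic issued from the boundary corner is a
weak solution. -/
lemma isWeakSolution_stepProfile {lam ξ v : ℝ → ℝ} {T : ℝ}
    (hξ : ∀ t ∈ Icc 0 T, HasDerivAt ξ (v t) t) (hvc : ContinuousOn v (Icc 0 T))
    (hv : ∀ t ∈ Icc 0 T, v t = lam (r₀ + (r₁ - r₀) * ξ t)) (hξ0 : ξ 0 = 0)
    (hξm : ∀ t ∈ Icc 0 T, ξ t ∈ Icc (0:ℝ) 1) :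
    IsWeakSolution lam T (fun _ => r₀) (fun t => v t * r₁) fun t => stepProfile r₀ r₁ (ξ t) := by
  have hint : ∀ t ∈ Icc (0:ℝ) T, IntegrableOn (stepProfile r₀ r₁ (ξ t)) (Ioc 0 1) :=
    fun t _ => integrableOn_stepProfile _
  have hL : ∀ t ∈ Icc (0:ℝ) T, ∀ ε > (0:ℝ), ∃ η > (0:ℝ), ∀ s ∈ Icc (0:ℝ) T, |s - t| < η →
      (∫ x in Ioc (0:ℝ) 1, |stepProfile r₀ r₁ (ξ s) x - stepProfile r₀ r₁ (ξ t) x|) < ε := by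
    intro t ht ε hε
    have hc : ContinuousAt (fun s => |r₁ - r₀| * |ξ s - ξ t|) t := by
      have := (hξ t ht).continuousAt
      fun_prop
    obtain ⟨η, hη, H⟩ := Metric.continuousAt_iff.1 hc ε hε
    refine ⟨η, hη, fun s _ hst => (integral_abs_stepProfile_sub_le _ _).trans_lt ?_⟩
    have := H (x := s) (by rwa [Real.dist_eq])
    simpa [Real.dist_eq, abs_mul] using this
  refine ⟨hint, hL, fun τ hτ φ hφ hφτ hφ1 => ?_⟩
  have hsub : Icc 0 τ ⊆ Icc 0 T := Icc_subset_Icc_right hτ.2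
  have hft := continuous_deriv_fst hφ
  have hfx := continuous_deriv_snd hφ
  have hftc : ∀ t, Continuous fun x => deriv (fun s => φ s x) t :=
    fun t => hft.comp (Continuous.prodMk_right t)
  have hfxc : ∀ t, Continuous (deriv (φ t)) := fun t => hfx.comp (Continuous.prodMk_right t)
  have hW : ∀ t ∈ Icc 0 T, lam (∫ y in Ioc (0:ℝ) 1, stepProfile r₀ r₁ (ξ t) y) = v t := by
    intro t ht
    have := integral_stepProfile_mul (r₀ := r₀) (r₁ := r₁) (hξm t ht) (g := fun _ => 1)
      continuous_const
    rw [hv t ht]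
    congr 1
    simp at this
    linarith
  set F : ℝ → ℝ := fun t => ∫ x in Ioc (0:ℝ) 1, stepProfile r₀ r₁ (ξ t) x *
    (deriv (fun s => φ s x) t + lam (∫ y in Ioc (0:ℝ) 1, stepProfile r₀ r₁ (ξ t) y)
      * deriv (φ t) x) with hF
  set G : ℝ → ℝ := fun t =>
    (r₁ - r₀) * (∫ x in (0:ℝ)..ξ t, φ t x) + r₀ * ∫ x in (0:ℝ)..1, φ t x with hG
  have hGd : ∀ t ∈ Icc 0 τ, HasDerivAt G (F t + v t * r₁ * φ t 0) t := by
    intro t ht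
    have hp : ∀ z, ∫ x in (0:ℝ)..z, (deriv (fun s => φ s x) t + v t * deriv (φ t) x)
        = (∫ x in (0:ℝ)..z, deriv (fun s => φ s x) t) + v t * (φ t z - φ t 0) := fun z => by
      rw [intervalIntegral.integral_add ((hftc t).intervalIntegrable _ _)
        (((hfxc t).const_mul _).intervalIntegrable _ _), intervalIntegral.integral_const_mul,
        integral_deriv_eq_sub (fun x _ => (hasDerivAt_snd hφ t x).differentiableAt)
          ((hfxc t).intervalIntegrable _ _)]
    have hFt : F t = (r₁ - r₀) * ((∫ x in (0:ℝ)..ξ t, deriv (fun s => φ s x) t)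
        + v t * (φ t (ξ t) - φ t 0))
        + r₀ * ((∫ x in (0:ℝ)..1, deriv (fun s => φ s x) t) + v t * (φ t 1 - φ t 0)) := by
      rw [← hp, ← hp, ← integral_stepProfile_mul (hξm t (hsub ht))
        (g := fun x => deriv (fun s => φ s x) t + v t * deriv (φ t) x)
        ((hftc t).add ((hfxc t).const_mul _))]
      simp only [hF, hW t (hsub ht)]
    refine (((hasDerivAt_integral_moving_endpoint hφ (hξ t (hsub ht))).const_mul _).add
      ((hasDerivAt_integral_const_endpoint hφ t 0 1).const_mul _)).congr_deriv ?_
    rw [hFt, hφ1 t ht]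
    ring
  have hFc : ContinuousOn F (Icc 0 T) := by
    refine ((continuousOn_integral_mul hint hL hft).add
      (hvc.mul (continuousOn_integral_mul hint hL hfx))).congr fun t ht => ?_
    simp only [hF, hW t ht, Pi.add_apply, Pi.mul_apply]
    rw [← MeasureTheory.integral_const_mul, ← MeasureTheory.integral_add
      (integrableOn_mul_of_continuous (hint t ht) (hftc t))
      ((integrableOn_mul_of_continuous (hint t ht) (hfxc t)).const_mul _)]
    congr 1
    ext x
    ring
  have huc : ContinuousOn (fun t => v t * r₁ * φ t 0) (Icc 0 T) :=
    (hvc.mul continuousOn_const).mul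
      (hφ.continuous.comp (Continuous.prodMk_left 0)).continuousOn
  have hFi : IntegrableOn F (Ioc 0 τ) :=
    (hFc.mono hsub).integrableOn_Icc.mono_set Ioc_subset_Icc_self
  have hui : IntegrableOn (fun t => v t * r₁ * φ t 0) (Ioc 0 τ) :=
    (huc.mono hsub).integrableOn_Icc.mono_set Ioc_subset_Icc_self
  have hFTC : ∫ t in (0:ℝ)..τ, (F t + v t * r₁ * φ t 0) = G τ - G 0 := by
    refine integral_eq_sub_of_hasDerivAt (fun t ht => hGd t (by rwa [uIcc_of_le hτ.1] at ht)) ?_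
    rw [intervalIntegrable_iff_integrableOn_Ioc_of_le hτ.1]
    exact hFi.add hui
  have hGτ : G τ = 0 := by
    have hz : ∀ z ∈ Icc (0:ℝ) 1, ∫ x in (0:ℝ)..z, φ τ x = 0 := fun z hz => by
      rw [intervalIntegral.integral_congr (g := fun _ => 0), intervalIntegral.integral_zero]
      intro x hx
      rw [uIcc_of_le hz.1] at hx
      exact hφτ x ⟨hx.1, hx.2.trans hz.2⟩
    simp only [hG, hz _ (hξm τ hτ), hz 1 ⟨zero_le_one, le_rfl⟩]
    ring
  have hG0 : G 0 = ∫ x in Ioc (0:ℝ) 1, r₀ * φ 0 x := by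
    simp only [hG, hξ0, integral_same]
    rw [intervalIntegral.integral_of_le zero_le_one, MeasureTheory.integral_const_mul]
    ring
  rw [← MeasureTheory.integral_add hFi hui, ← intervalIntegral.integral_of_le hτ.1, hFTC, hGτ, hG0]
  ring

end StepProfile

/-- The constant boundary datum `ρ(·, 0) = ρ1` realizes the transfer from `ρ0` to `ρ1` in time
`1 + (ρ0 + ρ1) / 2`. -/
lemma exists_transfer {ρ0 ρ1 : ℝ} (h0 : 0 ≤ ρ0) (h01 : ρ0 < ρ1) :
    ∃ u : ℝ → ℝ, ∃ ρ : ℝ → ℝ → ℝ,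
      IntegrableOn u (Ioc 0 (1 + (ρ0 + ρ1) / 2)) ∧
      (∀ᵐ t ∂(volume.restrict (Ioc (0:ℝ) (1 + (ρ0 + ρ1) / 2))), 0 ≤ u t) ∧
      IsWeakSolution (fun W => 1 / (1 + W)) (1 + (ρ0 + ρ1) / 2) (fun _ => ρ0) u ρ ∧
      ∀ᵐ x ∂(volume.restrict (Ioc (0:ℝ) 1)), ρ (1 + (ρ0 + ρ1) / 2) x = ρ1 := by
  set T := 1 + (ρ0 + ρ1) / 2 with hT
  have hd : 0 < ρ1 - ρ0 := sub_pos.2 h01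
  set D : ℝ → ℝ := fun t => (1 + ρ0) ^ 2 + 2 * (ρ1 - ρ0) * t with hD
  have hDpos : ∀ t, 0 ≤ t → 0 < D t := fun t ht => by positivity
  have hD0 : √(D 0) = 1 + ρ0 := by
    rw [show D 0 = (1 + ρ0) ^ 2 by simp [hD], Real.sqrt_sq (by linarith)]
  have hDT : √(D T) = 1 + ρ1 := by
    rw [show D T = (1 + ρ1) ^ 2 by simp only [hD, hT]; ring, Real.sqrt_sq (by linarith)]
  have hDmono : Monotone fun t => √(D t) := fun s t hst =>
    Real.sqrt_le_sqrt (by simp only [hD]; gcongr)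
  set ξ : ℝ → ℝ := fun t => (√(D t) - (1 + ρ0)) / (ρ1 - ρ0) with hξ
  set v : ℝ → ℝ := fun t => 1 / √(D t) with hv
  have hvc : ContinuousOn v (Icc 0 T) := continuousOn_const.div (by fun_prop)
    fun t ht => (Real.sqrt_pos.2 (hDpos t ht.1)).ne'
  have hξT : ξ T = 1 := by
    simp only [hξ, hDT]
    rw [add_sub_add_left_eq_sub, div_self hd.ne']
  refine ⟨fun t => v t * ρ1, fun t => stepProfile ρ0 ρ1 (ξ t), ?_, ?_, ?_, ?_⟩
  · exact (hvc.integrableOn_Icc.mono_set Ioc_subset_Icc_self).mul_const _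
  · exact ae_of_all _ fun t => mul_nonneg (by positivity) (h0.trans h01.le)
  · refine isWeakSolution_stepProfile (fun t ht => ?_) hvc (fun t _ => ?_) ?_ fun t ht => ⟨?_, ?_⟩
    · have hDd : HasDerivAt D (2 * (ρ1 - ρ0)) t :=
        (((hasDerivAt_id' t).const_mul _).const_add _).congr_deriv (mul_one _)
      refine (((hDd.sqrt (hDpos t ht.1).ne').sub_const _).div_const _).congr_deriv ?_
      simp only [hv]
      field_simp
    · simp only [hv, hξ]
      rw [mul_div_cancel₀ _ hd.ne']
      congr 1
      ring
    · simp [hξ, hD0]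
    · exact div_nonneg (sub_nonneg.2 (hD0 ▸ hDmono ht.1)) hd.le
    · rw [← hξT]
      exact div_le_div_of_nonneg_right (sub_le_sub_right (hDmono ht.2) _) hd.le
  · filter_upwards [ae_restrict_mem measurableSet_Ioc] with x hx
    simp [stepProfile, hξT, hx.2]

/-- Proposition 4.1: for the velocity `λ(W) = 1/(1+W)` and constants
`0 ≤ ρ₀ < ρ₁`, the minimum time `T` in which an admissible nonnegative `L¹`
influx can steer the system from the equilibrium `ρ ≡ ρ₀` to the equilibrium
`ρ(T,·) ≡ ρ₁` is exactly `T = 1 + (ρ₀ + ρ₁)/2`: this time is a lower bound for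
all admissible transfers, and it is attained (by the constant boundary datum
`ρ(·,0) = ρ₁`). -/
theorem time_optimal_transfer_between_equilibria
    (ρ0 ρ1 : ℝ) (h0 : 0 ≤ ρ0) (h01 : ρ0 < ρ1) :
    IsLeast
      {T : ℝ | 0 < T ∧ ∃ u : ℝ → ℝ, ∃ ρ : ℝ → ℝ → ℝ,
        MeasureTheory.IntegrableOn u (Set.Ioc 0 T) ∧
        (∀ᵐ t ∂(volume.restrict (Set.Ioc (0:ℝ) T)), 0 ≤ u t) ∧
        IsWeakSolution (fun W => 1 / (1 + W)) T (fun _ => ρ0) u ρ ∧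
        (∀ᵐ x ∂(volume.restrict (Set.Ioc (0:ℝ) 1)), ρ T x = ρ1)}
      (1 + (ρ0 + ρ1) / 2) := by
  constructor
  · refine ⟨by linarith, exists_transfer h0 h01⟩
  · rintro T ⟨hT, u, ρ, hu, hu0, hw, hr⟩
    exact hw.le_transfer_time h0 h01 hT hu hu0 hr
end
end
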